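/- Let n, k ∈ ℕ, p ∈ [1,∞), γ ∈ Γ_{p,1}, s ∈ (0,1), q₀ ∈ [1,∞), and q ∈ [1,q₀] satisfy 1/q = (1−s)/q₀ + s. Then there exists a constant C > 0 such that for every locally integrable f : ℝ^n → ℝ having weak derivatives of orders k−1 and k with |∇^{k−1} f| ∈ L^{pq₀}(ℝ^n) and |∇^k f| ∈ L^p(ℝ^n), sup_{λ∈(0,∞)} λ (∫_{ℝ^n}[∫_{ℝ^n} 1_{E_{λ,γ/q+s−1,k}[f]}(x,h) |h|^{γ−n} dh]^{p} dx)^{1/(pq)} ≤ C ‖|∇^{k−1} f|‖_{L^{pq₀}}^{1−s} ‖|∇^k f|‖_{L^p}^{s}. -/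

import Mathlib

open MeasureTheory Filter Set
open scoped ENNReal NNReal BigOperators Topology Classical

noncomputable section

/-- `ℝ^n`. -/
abbrev En (n : ℕ) := EuclideanSpace ℝ (Fin n)

variable {n : ℕ}

/-- The `k`-th order difference `Δ_h^k f (x) = ∑_{j=0}^k (-1)^{k-j} C(k,j) f (x + j h)`. -/
def kDiff (k : ℕ) (f : En n → ℝ) (h x : En n) : ℝ :=
  ∑ j ∈ Finset.range (k + 1), (-1 : ℝ) ^ (k - j) * (k.choose j : ℝ) * f (x + (j : ℝ) • h)

/-- Membership of `(x,h)` in `E_{λ,b,k,ℓ}[f]`. -/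
def memE (k ℓ : ℕ) (lam b : ℝ) (f : En n → ℝ) (x h : En n) : Prop :=
  h ≠ 0 ∧ lam * ‖h‖ ^ ((ℓ : ℝ) + b) < |kDiff k f h x|

/-- `∫_{ℝ^n} 1_{E_{λ,b,k,ℓ}[f]}(x,h) |h|^{γ-n} dh`. -/
def innerInt (k ℓ : ℕ) (lam b γ : ℝ) (f : En n → ℝ) (x : En n) : ℝ≥0∞ :=
  ∫⁻ h, if memE k ℓ lam b f x h then ENNReal.ofReal (‖h‖ ^ (γ - (n : ℝ))) else 0

/-- `λ (∫_{ℝ^n} (∫_{ℝ^n} 1_E |h|^{γ-n} dh)^{p/q} dx)^{1/p}`. -/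
def bsvy (k ℓ : ℕ) (p q b γ : ℝ) (f : En n → ℝ) (lam : ℝ) : ℝ≥0∞ :=
  ENNReal.ofReal lam * (∫⁻ x, (innerInt k ℓ lam b γ f x) ^ (p / q)) ^ (1 / p)

/-- First-order partial derivative in the `i`-th coordinate direction. -/
def pd (i : Fin n) (ψ : En n → ℝ) : En n → ℝ :=
  fun x => fderiv ℝ ψ x (EuclideanSpace.single i (1 : ℝ))

/-- Higher-order partial derivative `∂^α` associated with a multi-index `α`. -/
def mpd (α : Fin n → ℕ) (φ : En n → ℝ) : En n → ℝ :=
  (List.finRange n).foldr (fun i ψ => (pd i)^[α i] ψ) φ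

/-- `g` is the family of `m`-th order weak partial derivatives of `f`. -/
def HasWeakDerivs (m : ℕ) (f : En n → ℝ) (g : (Fin n → ℕ) → En n → ℝ) : Prop :=
  (∀ α : Fin n → ℕ, (∑ i, α i) = m → LocallyIntegrable (g α) volume) ∧
  ∀ α : Fin n → ℕ, (∑ i, α i) = m →
    ∀ φ : En n → ℝ, ContDiff ℝ (⊤ : ℕ∞) φ → HasCompactSupport φ →
      ∫ x, f x * mpd α φ x = (-1 : ℝ) ^ m * ∫ x, g α x * φ x

/-- `|∇^m f| = (∑_{|α| = m} |∂^α f|^2)^{1/2}`, given the family `g` of weak derivatives. -/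
def gradLen (m : ℕ) (g : (Fin n → ℕ) → En n → ℝ) (x : En n) : ℝ :=
  Real.sqrt (∑' α : Fin n → ℕ, if (∑ i, α i) = m then (g α x) ^ 2 else 0)

/-- The parameter range `Γ_{p,q}`. -/
def Gam (p q : ℝ) : Set ℝ := if p = 1 then Iio (-q) ∪ Ioi 0 else {(0 : ℝ)}ᶜ

/-- `‖ |∇^m f| ‖_{L^p}` as an `ℝ≥0∞`-valued quantity. -/
def gradLp (p : ℝ) (m : ℕ) (g : (Fin n → ℕ) → En n → ℝ) : ℝ≥0∞ :=
  (∫⁻ x, ENNReal.ofReal (gradLen m g x ^ p)) ^ (1 / p)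

end

/-- The weight `r ^ (γ - 1)` restricted to the radii `r` with `r ^ β < a`. -/
noncomputable def cutPow (β γ : ℝ) (a : ℝ≥0∞) (r : ℝ) : ℝ≥0∞ :=
  if ENNReal.ofReal (r ^ β) < a then ENNReal.ofReal (r ^ (γ - 1)) else 0

lemma measurable_cutPow {X : Type*} [MeasurableSpace X] (β γ : ℝ) {a : X → ℝ≥0∞} {r : X → ℝ}
    (ha : Measurable a) (hr : Measurable r) : Measurable fun x => cutPow β γ (a x) (r x) := by
  unfold cutPow
  refine Measurable.ite ?_ ?_ measurable_const
  · exact measurableSet_lt (by fun_prop) ha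
  · fun_prop

lemma cutPow_mono (β γ : ℝ) {a b : ℝ≥0∞} (h : a ≤ b) (r : ℝ) :
    cutPow β γ a r ≤ cutPow β γ b r := by
  unfold cutPow
  split_ifs with h1 h2
  · exact le_rfl
  · exact absurd (h1.trans_le h) h2
  · exact zero_le
  · exact le_rfl

lemma cutPow_max_le (β γ : ℝ) (a b : ℝ≥0∞) (r : ℝ) :
    cutPow β γ (max a b) r ≤ cutPow β γ a r + cutPow β γ b r := by
  rcases le_total a b with h | h
  · rw [max_eq_right h]; exact le_add_self
  · rw [max_eq_left h]; exact le_self_add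

lemma lintegral_Ioo_rpow {γ b : ℝ} (hγ : 0 < γ) (hb : 0 ≤ b) :
    ∫⁻ r in Ioo 0 b, ENNReal.ofReal (r ^ (γ - 1)) = ENNReal.ofReal (b ^ γ / γ) := by
  rw [← ofReal_integral_eq_lintegral_ofReal]
  · rw [← integral_Ioc_eq_integral_Ioo, ← intervalIntegral.integral_of_le hb,
      integral_rpow (Or.inl (by linarith))]
    simp [hγ.ne']
  · refine IntegrableOn.mono_set ?_ Ioo_subset_Ioc_self
    exact (intervalIntegrable_iff_integrableOn_Ioc_of_le hb).1
      (intervalIntegral.intervalIntegrable_rpow' (by linarith))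
  · filter_upwards [ae_restrict_mem measurableSet_Ioo] with r hr
    exact Real.rpow_nonneg hr.1.le _

lemma lintegral_Ioi_rpow {γ b : ℝ} (hγ : γ < 0) (hb : 0 < b) :
    ∫⁻ r in Ioi b, ENNReal.ofReal (r ^ (γ - 1)) = ENNReal.ofReal (b ^ γ / |γ|) := by
  rw [← ofReal_integral_eq_lintegral_ofReal]
  · rw [integral_Ioi_rpow_of_lt (by linarith) hb, abs_of_neg hγ]
    congr 1
    simp only [sub_add_cancel]
    rw [div_neg, neg_div]
  · exact integrableOn_Ioi_rpow_of_lt (by linarith) hb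
  · filter_upwards [ae_restrict_mem measurableSet_Ioi] with r hr
    exact Real.rpow_nonneg (hb.trans hr).le _

lemma lintegral_cutPow_ofReal {γ : ℝ} (hγ : γ ≠ 0) {a : ℝ} (ha : 0 < a) :
    ∫⁻ r in Ioi 0, cutPow γ γ (ENNReal.ofReal a) r = ENNReal.ofReal (a / |γ|) := by
  have hbpos : 0 < a ^ (1 / γ) := Real.rpow_pos_of_pos ha _
  have hbγ : (a ^ (1 / γ)) ^ γ = a := by
    rw [← Real.rpow_mul ha.le, one_div_mul_cancel hγ, Real.rpow_one]
  set b := a ^ (1 / γ) with hb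
  rcases lt_or_gt_of_ne hγ with h | h
  · have : ∫⁻ r in Ioi 0, cutPow γ γ (ENNReal.ofReal a) r
        = ∫⁻ r in Ioi 0, (Ioi b).indicator (fun r => ENNReal.ofReal (r ^ (γ - 1))) r := by
      refine setLIntegral_congr_fun measurableSet_Ioi fun r hr => ?_
      simp only [cutPow, indicator_apply, mem_Ioi, ENNReal.ofReal_lt_ofReal_iff ha]
      simp only [← hbγ, Real.rpow_lt_rpow_iff_of_neg hr hbpos h]
    rw [this, setLIntegral_indicator measurableSet_Ioi, inter_eq_left.2 (Ioi_subset_Ioi hbpos.le),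
      lintegral_Ioi_rpow h hbpos, hbγ]
  · have : ∫⁻ r in Ioi 0, cutPow γ γ (ENNReal.ofReal a) r
        = ∫⁻ r in Ioi 0, (Iio b).indicator (fun r => ENNReal.ofReal (r ^ (γ - 1))) r := by
      refine setLIntegral_congr_fun measurableSet_Ioi fun r hr => ?_
      simp only [cutPow, indicator_apply, mem_Iio, ENNReal.ofReal_lt_ofReal_iff ha]
      simp only [← hbγ, Real.rpow_lt_rpow_iff (le_of_lt hr) hbpos.le h]
    rw [this, setLIntegral_indicator measurableSet_Iio, Iio_inter_Ioi,
      lintegral_Ioo_rpow h hbpos.le, hbγ, abs_of_pos h]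

lemma lintegral_cutPow {γ : ℝ} (hγ : γ ≠ 0) (a : ℝ≥0∞) :
    ∫⁻ r in Ioi 0, cutPow γ γ a r = a / ENNReal.ofReal |γ| := by
  have hγ' : 0 < |γ| := abs_pos.2 hγ
  rcases eq_or_ne a 0 with rfl | ha0
  · simp [cutPow]
  rcases eq_or_ne a ∞ with rfl | ha
  · rw [ENNReal.top_div_of_ne_top ENNReal.ofReal_ne_top]
    refine ENNReal.eq_top_of_forall_nnreal_le fun c => ?_
    have hc : 0 < ((c : ℝ) + 1) * |γ| := by positivity
    calc (c : ℝ≥0∞) ≤ ENNReal.ofReal (((c : ℝ) + 1) * |γ| / |γ|) := by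
          rw [mul_div_cancel_right₀ _ hγ'.ne', ← ENNReal.ofReal_coe_nnreal]
          exact ENNReal.ofReal_le_ofReal (by linarith)
      _ = _ := (lintegral_cutPow_ofReal hγ hc).symm
      _ ≤ _ := lintegral_mono fun r => cutPow_mono _ _ le_top _
  · rw [← ENNReal.ofReal_toReal ha, lintegral_cutPow_ofReal hγ (ENNReal.toReal_pos ha0 ha),
      ENNReal.ofReal_div_of_pos hγ']

/-- The layer cake formula combined with a weak-type estimate localised to the large values of the
majorant. -/
lemma lintegral_rpow_le_of_weak {X : Type*} [MeasurableSpace X] {μ : Measure X} [SFinite μ]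
    {p c : ℝ} (hp : 1 < p) (hc : 0 < c) {C : ℝ≥0∞} {u v : X → ℝ≥0∞} (hu : Measurable u)
    (hv : Measurable v)
    (h : ∀ l : ℝ, 0 < l → ENNReal.ofReal l * μ {x | ENNReal.ofReal l < v x} ≤
      C * ∫⁻ x in {x | ENNReal.ofReal (c * l) < u x}, u x ∂μ) :
    ∫⁻ x, v x ^ p ∂μ ≤
      ENNReal.ofReal (p / (p - 1) / c ^ (p - 1)) * C * ∫⁻ x, u x ^ p ∂μ := by
  have hp0 : 0 < p := by linarith
  have hp1 : 0 < p - 1 := by linarith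
  have hpn : ENNReal.ofReal p ≠ 0 := by simpa using hp0
  have e1 : ∀ x, v x ^ p = ENNReal.ofReal p * ∫⁻ r in Ioi 0, cutPow p p (v x ^ p) r := fun x => by
    rw [lintegral_cutPow hp0.ne', abs_of_pos hp0, ENNReal.mul_div_cancel hpn ENNReal.ofReal_ne_top]
  have e2 : ∀ x, u x ^ p * ENNReal.ofReal (1 / (p - 1) / c ^ (p - 1))
      = ∫⁻ r in Ioi 0, u x * cutPow (p - 1) (p - 1) ((u x / ENNReal.ofReal c) ^ (p - 1)) r := by
    intro x
    rw [lintegral_const_mul _ (measurable_cutPow _ _ measurable_const measurable_id'),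
      lintegral_cutPow hp1.ne', abs_of_pos hp1, ENNReal.div_rpow_of_nonneg _ _ hp1.le,
      ENNReal.ofReal_rpow_of_pos hc, div_div, ENNReal.ofReal_div_of_pos (by positivity),
      ENNReal.ofReal_mul hp1.le, ENNReal.ofReal_one]
    have : u x ^ p = u x * u x ^ (p - 1) := by
      conv_lhs => rw [show p = 1 + (p - 1) by ring]
      rw [ENNReal.rpow_add_of_nonneg _ _ zero_le_one hp1.le, ENNReal.rpow_one]
    rw [this]
    have h3 : ENNReal.ofReal (c ^ (p - 1)) ≠ 0 := by simpa using by positivity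
    simp only [div_eq_mul_inv, one_mul]
    rw [ENNReal.mul_inv (Or.inr ENNReal.ofReal_ne_top) (Or.inl ENNReal.ofReal_ne_top)]
    ring
  have m1 : Measurable (fun z : X × ℝ => cutPow p p (v z.1 ^ p) z.2) :=
    measurable_cutPow _ _ (by fun_prop) (by fun_prop)
  have m2 : Measurable (fun z : X × ℝ =>
      u z.1 * cutPow (p - 1) (p - 1) ((u z.1 / ENNReal.ofReal c) ^ (p - 1)) z.2) :=
    (hu.comp measurable_fst).mul (measurable_cutPow _ _ (by fun_prop) (by fun_prop))
  have key : ∀ r ∈ Ioi (0 : ℝ), ∫⁻ x, cutPow p p (v x ^ p) r ∂μ ≤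
      C * ∫⁻ x, u x * cutPow (p - 1) (p - 1) ((u x / ENNReal.ofReal c) ^ (p - 1)) r ∂μ := by
    intro r (hr : 0 < r)
    have i1 : ∫⁻ x, cutPow p p (v x ^ p) r ∂μ
        = ENNReal.ofReal (r ^ (p - 1)) * μ {x | ENNReal.ofReal r < v x} := by
      rw [← setLIntegral_const, ← lintegral_indicator (measurableSet_lt measurable_const hv)]
      refine lintegral_congr fun x => ?_
      simp only [cutPow, indicator_apply, mem_ofPred_eq, ← ENNReal.ofReal_rpow_of_pos hr,
        ENNReal.rpow_lt_rpow_iff hp0]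
    have i2 : ∫⁻ x, u x * cutPow (p - 1) (p - 1) ((u x / ENNReal.ofReal c) ^ (p - 1)) r ∂μ
        = ENNReal.ofReal (r ^ (p - 2)) *
          ∫⁻ x in {x | ENNReal.ofReal (c * r) < u x}, u x ∂μ := by
      rw [← lintegral_const_mul _ hu,
        ← lintegral_indicator (measurableSet_lt measurable_const hu)]
      refine lintegral_congr fun x => ?_
      have : (ENNReal.ofReal r < u x / ENNReal.ofReal c) ↔ ENNReal.ofReal (c * r) < u x := by
        rw [ENNReal.lt_div_iff_mul_lt (Or.inl (by simpa using hc)) (Or.inl ENNReal.ofReal_ne_top),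
          ← ENNReal.ofReal_mul hr.le, mul_comm r c]
      simp only [cutPow, indicator_apply, mem_ofPred_eq, ← ENNReal.ofReal_rpow_of_pos hr,
        ENNReal.rpow_lt_rpow_iff hp1, this]
      rw [show p - 1 - 1 = p - 2 by ring, mul_ite, mul_zero, mul_comm (u x)]
    rw [i1, i2]
    calc ENNReal.ofReal (r ^ (p - 1)) * μ {x | ENNReal.ofReal r < v x}
        = ENNReal.ofReal (r ^ (p - 2)) *
          (ENNReal.ofReal r * μ {x | ENNReal.ofReal r < v x}) := by
          rw [← mul_assoc, ← ENNReal.ofReal_mul (by positivity)]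
          congr 2
          rw [show p - 1 = (p - 2) + 1 by ring, Real.rpow_add_one hr.ne']
      _ ≤ _ := by
          rw [mul_left_comm C]
          gcongr ENNReal.ofReal (r ^ (p - 2)) * ?_
          exact h r hr
  calc ∫⁻ x, v x ^ p ∂μ
      = ENNReal.ofReal p * ∫⁻ x, (∫⁻ r in Ioi (0 : ℝ), cutPow p p (v x ^ p) r) ∂μ := by
        rw [← lintegral_const_mul _ m1.lintegral_prod_right']
        exact lintegral_congr e1
    _ = ENNReal.ofReal p * ∫⁻ r in Ioi (0 : ℝ), (∫⁻ x, cutPow p p (v x ^ p) r ∂μ) := by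
        rw [lintegral_lintegral_swap m1.aemeasurable]
    _ ≤ ENNReal.ofReal p * ∫⁻ r in Ioi (0 : ℝ), C *
          ∫⁻ x, u x * cutPow (p - 1) (p - 1) ((u x / ENNReal.ofReal c) ^ (p - 1)) r ∂μ := by
        gcongr ENNReal.ofReal p * ?_
        exact setLIntegral_mono' measurableSet_Ioi key
    _ = ENNReal.ofReal p * (C * ∫⁻ x, (∫⁻ r in Ioi (0 : ℝ),
          u x * cutPow (p - 1) (p - 1) ((u x / ENNReal.ofReal c) ^ (p - 1)) r) ∂μ) := by
        rw [lintegral_const_mul _ m2.lintegral_prod_left', lintegral_lintegral_swap (f := fun x r =>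
          u x * cutPow (p - 1) (p - 1) ((u x / ENNReal.ofReal c) ^ (p - 1)) r) m2.aemeasurable]
    _ = _ := by
        simp_rw [← e2]
        rw [lintegral_mul_const _ (hu.pow_const p),
          show p / (p - 1) / c ^ (p - 1) = p * (1 / (p - 1) / c ^ (p - 1)) by ring,
          ENNReal.ofReal_mul hp0.le]
        ring

lemma exists_disjoint_intervals {κ : ℝ} (hκ : 0 < κ) (u : ℝ → ℝ≥0∞) (Θ : ℝ → ℝ≥0∞) (δ : ℝ → ℝ)
    {E : Set (ℝ × ℝ)} (hpos : ∀ z ∈ E, 0 < z.2)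
    (hΘ : ∀ z ∈ E, Θ z.2 ≤ ∫⁻ y in Icc z.1 (z.1 + κ * z.2), u y)
    (hδ : ∀ z ∈ E, 0 ≤ δ z.2) {R : ℝ} (hR : ∀ z ∈ E, δ z.2 ≤ R) :
    ∃ F ⊆ E, F.Countable ∧
      (∀ z ∈ E, ∃ b ∈ F, |z.1 - b.1| ≤ κ * (z.2 + b.2) ∧ δ z.2 ≤ 2 * δ b.2) ∧
      ∑' b : F, Θ b.1.2 ≤ ∫⁻ y, u y := by
  obtain ⟨F, hFE, hdisj, hcov⟩ := Vitali.exists_disjoint_subfamily_covering_enlargement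
    (fun z : ℝ × ℝ => Icc z.1 (z.1 + κ * z.2)) E (fun z => δ z.2) 2 one_lt_two hδ R hR
    (fun z hz => nonempty_Icc.2 (by nlinarith [mul_pos hκ (hpos z hz)]))
  have hcount : F.Countable := hdisj.countable_of_nonempty_interior fun z hz => by
    rw [interior_Icc]
    exact nonempty_Ioo.2 (by nlinarith [mul_pos hκ (hpos z (hFE hz))])
  refine ⟨F, hFE, hcount, fun z hz => ?_, ?_⟩
  · obtain ⟨b, hb, ⟨y, hy1, hy2⟩, h⟩ := hcov z hz
    refine ⟨b, hb, ?_, h⟩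
    have h1 := mul_pos hκ (hpos z hz)
    have h2 := mul_pos hκ (hpos b (hFE hb))
    rw [abs_le]
    constructor <;> nlinarith [hy1.1, hy1.2, hy2.1, hy2.2]
  · have : Countable F := hcount.to_subtype
    calc ∑' b : F, Θ b.1.2
        ≤ ∑' b : F, ∫⁻ y in Icc b.1.1 (b.1.1 + κ * b.1.2), u y :=
          ENNReal.tsum_le_tsum fun b => hΘ b.1 (hFE b.2)
      _ = ∫⁻ y in ⋃ b : F, Icc b.1.1 (b.1.1 + κ * b.1.2), u y := by
          rw [lintegral_iUnion (fun _ => measurableSet_Icc)]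
          exact hdisj.subtype _ _
      _ ≤ ∫⁻ y, u y := setLIntegral_le_lintegral _ _

lemma measurable_lintegral_Icc (κ : ℝ) {u : ℝ → ℝ≥0∞} (hu : Measurable u) :
    Measurable fun z : ℝ × ℝ => ∫⁻ y in Icc z.1 (z.1 + κ * z.2), u y := by
  have h : Measurable fun w : (ℝ × ℝ) × ℝ =>
      ({w : (ℝ × ℝ) × ℝ | w.1.1 ≤ w.2 ∧ w.2 ≤ w.1.1 + κ * w.1.2}).indicator (fun w => u w.2) w := by
    refine (hu.comp measurable_snd).indicator ?_
    exact (measurableSet_le (f := fun w : (ℝ × ℝ) × ℝ => w.1.1) (by fun_prop)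
      measurable_snd).inter (measurableSet_le (g := fun w : (ℝ × ℝ) × ℝ => w.1.1 + κ * w.1.2)
      measurable_snd (by fun_prop))
  convert h.lintegral_prod_right' (ν := volume) using 2 with z
  rw [← lintegral_indicator measurableSet_Icc]
  rfl

/-- The one-sided dyadic maximal function. -/
noncomputable def dyadicMax (u : ℝ → ℝ≥0∞) (t : ℝ) : ℝ≥0∞ :=
  ⨆ j : ℤ, (∫⁻ y in Icc t (t + 1 * 2 ^ j), u y) / ENNReal.ofReal (2 ^ j)

lemma measurable_dyadicMax {u : ℝ → ℝ≥0∞} (hu : Measurable u) : Measurable (dyadicMax u) := by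
  refine Measurable.iSup fun j => Measurable.div_const ?_ _
  exact (measurable_lintegral_Icc 1 hu).comp (measurable_id'.prodMk measurable_const)

lemma lintegral_Icc_le_dyadicMax (u : ℝ → ℝ≥0∞) (t : ℝ) {r : ℝ} (hr : 0 < r) :
    ∫⁻ y in Icc t (t + r), u y ≤ ENNReal.ofReal (2 * r) * dyadicMax u t := by
  obtain ⟨j, hj1, hj2⟩ := exists_mem_Ioc_zpow hr one_lt_two
  have hj : (0 : ℝ) < 2 ^ (j + 1) := by positivity
  have hj3 : (2 : ℝ) ^ (j + 1) ≤ 2 * r := by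
    rw [zpow_add_one₀ two_ne_zero]; linarith
  calc ∫⁻ y in Icc t (t + r), u y ≤ ∫⁻ y in Icc t (t + 1 * 2 ^ (j + 1)), u y :=
        lintegral_mono_set (Icc_subset_Icc_right (by linarith))
    _ = ENNReal.ofReal (2 ^ (j + 1)) *
        ((∫⁻ y in Icc t (t + 1 * 2 ^ (j + 1)), u y) / ENNReal.ofReal (2 ^ (j + 1))) := by
        rw [ENNReal.mul_div_cancel (by simpa using hj) ENNReal.ofReal_ne_top]
    _ ≤ _ := by
        gcongr
        exact le_iSup (fun j : ℤ => (∫⁻ y in Icc t (t + 1 * 2 ^ j), u y) /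
          ENNReal.ofReal (2 ^ j)) (j + 1)

lemma dyadicMax_weak (u : ℝ → ℝ≥0∞) {l : ℝ} (hl : 0 < l) :
    ENNReal.ofReal l * volume {t | ENNReal.ofReal l < dyadicMax u t} ≤ 6 * ∫⁻ y, u y := by
  rcases eq_or_ne (∫⁻ y, u y) ∞ with hU | hU
  · rw [hU, ENNReal.mul_top (by norm_num)]; exact le_top
  let E : Set (ℝ × ℝ) := {z | 0 < z.2 ∧
    ENNReal.ofReal (l * z.2) < ∫⁻ y in Icc z.1 (z.1 + 1 * z.2), u y}
  obtain ⟨F, hFE, hFc, hcov, hsum⟩ := exists_disjoint_intervals one_pos u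
    (fun r => ENNReal.ofReal (l * r)) id (E := E) (fun z hz => hz.1) (fun z hz => hz.2.le)
    (fun z hz => hz.1.le) (R := (∫⁻ y, u y).toReal / l) (fun z hz => by
      have h := hz.2.le.trans (setLIntegral_le_lintegral _ _)
      rw [ENNReal.ofReal_le_iff_le_toReal hU] at h
      rw [id, le_div_iff₀ hl]; linarith)
  have : Countable F := hFc.to_subtype
  have hsub : {t | ENNReal.ofReal l < dyadicMax u t} ⊆
      ⋃ b : F, Metric.closedBall b.1.1 (3 * b.1.2) := by
    intro t ht
    obtain ⟨j, hj⟩ := lt_iSup_iff.1 (show ENNReal.ofReal l < dyadicMax u t from ht)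
    have hj0 : (0 : ℝ) < 2 ^ j := by positivity
    have hE : (t, (2 : ℝ) ^ j) ∈ E := by
      refine ⟨hj0, ?_⟩
      rw [ENNReal.lt_div_iff_mul_lt (Or.inl (by simpa using hj0))
        (Or.inl ENNReal.ofReal_ne_top)] at hj
      rwa [ENNReal.ofReal_mul hl.le]
    obtain ⟨b, hb, h1, h2⟩ := hcov _ hE
    refine mem_iUnion.2 ⟨⟨b, hb⟩, ?_⟩
    simp only [id] at h2
    rw [Metric.mem_closedBall, Real.dist_eq]
    simp only at h1
    linarith
  calc ENNReal.ofReal l * volume {t | ENNReal.ofReal l < dyadicMax u t}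
      ≤ ENNReal.ofReal l * ∑' b : F, volume (Metric.closedBall b.1.1 (3 * b.1.2)) := by
        gcongr
        exact (measure_mono hsub).trans (measure_iUnion_le _)
    _ = 6 * ∑' b : F, ENNReal.ofReal (l * b.1.2) := by
        rw [← ENNReal.tsum_mul_left, ← ENNReal.tsum_mul_left]
        refine tsum_congr fun b => ?_
        rw [Real.volume_closedBall, ← ENNReal.ofReal_mul hl.le,
          show (6 : ℝ≥0∞) = ENNReal.ofReal 6 by norm_num, ← ENNReal.ofReal_mul (by norm_num)]
        congr 1; ring
    _ ≤ _ := by gcongr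

lemma le_indicator_add (u : ℝ → ℝ≥0∞) (a : ℝ≥0∞) (y : ℝ) :
    u y ≤ max ({x | a < u x}.indicator u y) a := by
  by_cases h : a < u y
  · rw [indicator_of_mem (by exact h)]; exact le_max_left _ _
  · exact (not_lt.1 h).trans (le_max_right _ _)

lemma dyadicMax_le_add (u : ℝ → ℝ≥0∞) (a : ℝ≥0∞) (t : ℝ) :
    dyadicMax u t ≤ dyadicMax ({x | a < u x}.indicator u) t + a := by
  refine iSup_le fun j => ?_
  have hj0 : (0 : ℝ) < 2 ^ j := by positivity
  have h0 : ENNReal.ofReal (2 ^ j) ≠ 0 := by simpa using hj0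
  calc (∫⁻ y in Icc t (t + 1 * 2 ^ j), u y) / ENNReal.ofReal (2 ^ j)
      ≤ (∫⁻ y in Icc t (t + 1 * 2 ^ j), ({x | a < u x}.indicator u y + a)) /
        ENNReal.ofReal (2 ^ j) := by
        gcongr with y
        exact (le_indicator_add u a y).trans (max_le_add_of_nonneg zero_le zero_le)
    _ = (∫⁻ y in Icc t (t + 1 * 2 ^ j), {x | a < u x}.indicator u y) /
        ENNReal.ofReal (2 ^ j) + a := by
        rw [lintegral_add_right _ measurable_const, setLIntegral_const, Real.volume_Icc,
          ENNReal.add_div, show t + 1 * 2 ^ j - t = (2 : ℝ) ^ j by ring,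
          ENNReal.mul_div_cancel_right h0 ENNReal.ofReal_ne_top]
    _ ≤ _ := by
        gcongr
        exact le_iSup (fun j : ℤ => (∫⁻ y in Icc t (t + 1 * 2 ^ j),
          {x | a < u x}.indicator u y) / ENNReal.ofReal (2 ^ j)) j

lemma lt_half_of_lt_add_half {l : ℝ} {a : ℝ≥0∞}
    (h : ENNReal.ofReal l < a + ENNReal.ofReal (1 / 2 * l)) : ENNReal.ofReal (1 / 2 * l) < a := by
  by_contra hn
  rw [not_lt] at hn
  refine absurd (h.trans_le (add_le_add_left hn _)) (not_lt.2 ?_)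
  rcases le_total 0 l with h0 | h0
  · rw [← ENNReal.ofReal_add (by linarith) (by linarith)]
    exact ENNReal.ofReal_le_ofReal (by linarith)
  · rw [ENNReal.ofReal_of_nonpos (by linarith : 1 / 2 * l ≤ 0)]; simp

lemma two_mul_ofReal_half (l : ℝ) : ENNReal.ofReal l = 2 * ENNReal.ofReal (1 / 2 * l) := by
  rw [show (2 : ℝ≥0∞) = ENNReal.ofReal 2 by norm_num, ← ENNReal.ofReal_mul (by norm_num)]
  congr 1; ring

lemma lintegral_dyadicMax_rpow_le {p : ℝ} (hp : 1 < p) :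
    ∃ C : ℝ≥0, ∀ u : ℝ → ℝ≥0∞, Measurable u →
      ∫⁻ t, dyadicMax u t ^ p ≤ C * ∫⁻ t, u t ^ p := by
  refine ⟨Real.toNNReal (p / (p - 1) / (1 / 2) ^ (p - 1)) * 12, fun u hu => ?_⟩
  have := lintegral_rpow_le_of_weak (μ := volume) hp (c := 1 / 2) (by norm_num) (C := 12) hu
    (measurable_dyadicMax hu) fun l hl => by
      rw [← lintegral_indicator (measurableSet_lt measurable_const hu), two_mul_ofReal_half]
      calc 2 * ENNReal.ofReal (1 / 2 * l) *
              volume {t | 2 * ENNReal.ofReal (1 / 2 * l) < dyadicMax u t}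
          ≤ 2 * ENNReal.ofReal (1 / 2 * l) * volume {t | ENNReal.ofReal (1 / 2 * l) <
              dyadicMax ({x | ENNReal.ofReal (1 / 2 * l) < u x}.indicator u) t} := by
            refine mul_le_mul_right (measure_mono fun t ht => ?_) _
            rw [mem_ofPred_eq, ← two_mul_ofReal_half] at ht
            exact lt_half_of_lt_add_half (ht.trans_le (dyadicMax_le_add u _ t))
        _ ≤ 2 * (6 * ∫⁻ y, {x | ENNReal.ofReal (1 / 2 * l) < u x}.indicator u y) := by
            rw [mul_assoc]
            refine mul_le_mul_right ?_ _
            exact dyadicMax_weak _ (by linarith)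
        _ = _ := by rw [← mul_assoc]; norm_num
  refine this.trans (le_of_eq ?_)
  rw [ENNReal.coe_mul]
  rfl

lemma lintegral_lintegral_cutPow_Icc_le_of_cover {κ γ : ℝ} (hκ : 0 < κ) (δ : ℝ → ℝ)
    (ρ : ℝ → ℝ → ℝ) (s : ℝ → Set ℝ) (hρ : ∀ b, Measurable (ρ b)) (hs : ∀ b, MeasurableSet (s b))
    (hδ : ∀ r, 0 < r → 0 ≤ δ r)
    (hcov : ∀ b, 0 < b → ∀ r, 0 < r → δ r ≤ 2 * δ b → r ∈ s b ∧ κ * (r + b) ≤ ρ b r) {C : ℝ≥0∞}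
    (hC : ∀ b, 0 < b → ∫⁻ r in s b ∩ Ioi 0, ENNReal.ofReal (2 * ρ b r) *
      ENNReal.ofReal (r ^ (γ - 1)) ≤ C * ENNReal.ofReal (b ^ (1 + γ)))
    {u : ℝ → ℝ≥0∞} {R : ℝ}
    (hR : ∀ r, 0 < r → ENNReal.ofReal (r ^ (1 + γ)) ≤ ∫⁻ y, u y → δ r ≤ R) :
    ∫⁻ t, ∫⁻ r in Ioi 0, cutPow (1 + γ) γ (∫⁻ y in Icc t (t + κ * r), u y) r ≤
      C * ∫⁻ y, u y := by
  let E : Set (ℝ × ℝ) := {z | 0 < z.2 ∧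
    ENNReal.ofReal (z.2 ^ (1 + γ)) < ∫⁻ y in Icc z.1 (z.1 + κ * z.2), u y}
  obtain ⟨F, hFE, hFc, hcover, hsum⟩ := exists_disjoint_intervals hκ u
    (fun r => ENNReal.ofReal (r ^ (1 + γ))) δ (E := E) (fun z hz => hz.1) (fun z hz => hz.2.le)
    (fun z hz => hδ _ hz.1) (R := R)
    (fun z hz => hR _ hz.1 (hz.2.le.trans (setLIntegral_le_lintegral _ _)))
  have : Countable F := hFc.to_subtype
  let K : F → ℝ × ℝ → ℝ≥0∞ := fun b z => ({z : ℝ × ℝ | z.2 ∈ s b.1.2 ∧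
    |z.1 - b.1.1| ≤ ρ b.1.2 z.2}).indicator (fun z => ENNReal.ofReal (z.2 ^ (γ - 1))) z
  have hK : ∀ b, Measurable (K b) := fun b => by
    refine Measurable.indicator (by fun_prop) (MeasurableSet.inter ?_ ?_)
    · exact measurable_snd (hs b.1.2)
    · exact measurableSet_le (f := fun z : ℝ × ℝ => |z.1 - b.1.1|) (by fun_prop)
        ((hρ b.1.2).comp measurable_snd)
  have hle : ∀ t, ∀ r ∈ Ioi (0 : ℝ),
      cutPow (1 + γ) γ (∫⁻ y in Icc t (t + κ * r), u y) r ≤ ∑' b, K b (t, r) := by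
    intro t r (hr : 0 < r)
    unfold cutPow
    split_ifs with h
    · obtain ⟨b, hb, h1, h2⟩ := hcover (t, r) ⟨hr, h⟩
      obtain ⟨h3, h4⟩ := hcov b.2 (hFE hb).1 r hr h2
      refine le_trans ?_ (ENNReal.le_tsum ⟨b, hb⟩)
      simp only [K]
      rw [indicator_of_mem]
      exact ⟨h3, h1.trans h4⟩
    · exact zero_le
  have hKint : ∀ b : F, ∫⁻ r in Ioi (0 : ℝ), ∫⁻ t, K b (t, r) ≤
      C * ENNReal.ofReal (b.1.2 ^ (1 + γ)) := by
    intro b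
    refine le_trans (le_of_eq ?_) (hC b.1.2 (hFE b.2).1)
    rw [← setLIntegral_indicator (hs _)]
    refine lintegral_congr fun r => ?_
    simp only [indicator_apply, K]
    split_ifs with h
    · rw [← Real.volume_closedBall (a := b.1.1), mul_comm, ← setLIntegral_const,
        ← lintegral_indicator Metric.isClosed_closedBall.measurableSet]
      refine lintegral_congr fun t => ?_
      simp [indicator_apply, h, Real.dist_eq]
    · simp [h]
  calc ∫⁻ t, ∫⁻ r in Ioi 0, cutPow (1 + γ) γ (∫⁻ y in Icc t (t + κ * r), u y) r
      ≤ ∫⁻ t, ∫⁻ r in Ioi (0 : ℝ), ∑' b, K b (t, r) :=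
        lintegral_mono fun t => setLIntegral_mono' measurableSet_Ioi (hle t)
    _ = ∑' b, ∫⁻ t, ∫⁻ r in Ioi (0 : ℝ), K b (t, r) := by
        rw [← lintegral_tsum fun b => (hK b).lintegral_prod_right'.aemeasurable]
        refine lintegral_congr fun t => ?_
        exact lintegral_tsum fun b => ((hK b).comp measurable_prodMk_left).aemeasurable
    _ ≤ ∑' b : F, C * ENNReal.ofReal (b.1.2 ^ (1 + γ)) := by
        refine ENNReal.tsum_le_tsum fun b => ?_
        rw [lintegral_lintegral_swap (f := fun t r => K b (t, r)) (hK b).aemeasurable]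
        exact hKint b
    _ ≤ _ := by
        rw [ENNReal.tsum_mul_left]
        gcongr

lemma lintegral_lintegral_cutPow_Icc_le {κ γ : ℝ} (hκ : 0 < κ) (hγ : γ < -1 ∨ 0 < γ) :
    ∃ C : ℝ≥0, ∀ u : ℝ → ℝ≥0∞,
      ∫⁻ t, ∫⁻ r in Ioi 0, cutPow (1 + γ) γ (∫⁻ y in Icc t (t + κ * r), u y) r ≤
        C * ∫⁻ y, u y := by
  rcases hγ with hγ | hγ
  · refine ⟨Real.toNNReal (6 * κ * ((1 / 3) ^ (1 + γ) / |1 + γ|)) + 1, fun u => ?_⟩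
    rcases eq_or_ne (∫⁻ y, u y) ∞ with hU | hU
    · rw [hU, ENNReal.mul_top (by simp)]; exact le_top
    refine lintegral_lintegral_cutPow_Icc_le_of_cover hκ (fun r => r⁻¹) (fun _ r => 3 * κ * r)
      (fun b => Ioi (1 / 3 * b)) (fun b => by fun_prop) (fun b => measurableSet_Ioi)
      (fun r hr => by positivity) (fun b hb r hr h => ?_) (fun b hb => ?_)
      (R := (∫⁻ y, u y).toReal ^ (-1 / (1 + γ))) (fun r hr h => ?_)
    · have h1 : b ≤ 2 * r := by
        have := mul_le_mul_of_nonneg_left h (mul_pos hr hb).le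
        field_simp at this
        linarith
      exact ⟨show 1 / 3 * b < r by linarith, by nlinarith⟩
    · rw [inter_eq_left.2 (Ioi_subset_Ioi (by positivity))]
      calc ∫⁻ r in Ioi (1 / 3 * b), ENNReal.ofReal (2 * (3 * κ * r)) * ENNReal.ofReal (r ^ (γ - 1))
          = ∫⁻ r in Ioi (1 / 3 * b), ENNReal.ofReal (6 * κ) *
            ENNReal.ofReal (r ^ (1 + γ - 1)) := by
            refine setLIntegral_congr_fun measurableSet_Ioi fun r hr => ?_
            have hr0 : 0 < r := lt_trans (by positivity) hr
            rw [← ENNReal.ofReal_mul (by positivity), ← ENNReal.ofReal_mul (by positivity)]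
            congr 1
            rw [show 1 + γ - 1 = (γ - 1) + 1 by ring, Real.rpow_add_one hr0.ne']
            ring
        _ = ENNReal.ofReal (6 * κ * ((1 / 3) ^ (1 + γ) / |1 + γ|)) *
            ENNReal.ofReal (b ^ (1 + γ)) := by
            rw [lintegral_const_mul _ (by fun_prop), lintegral_Ioi_rpow (by linarith)
              (by positivity), Real.mul_rpow (by norm_num) hb.le,
              ← ENNReal.ofReal_mul (by positivity), ← ENNReal.ofReal_mul (by positivity)]
            congr 1; ring
        _ ≤ _ := by
            gcongr
            rw [ENNReal.coe_add]
            exact le_self_add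
    · rw [ENNReal.ofReal_le_iff_le_toReal hU] at h
      calc r⁻¹ = (r ^ (1 + γ)) ^ (-1 / (1 + γ)) := by
            rw [← Real.rpow_mul hr.le, mul_div_cancel₀ _ (by linarith), Real.rpow_neg_one]
        _ ≤ _ := Real.rpow_le_rpow (by positivity) h
            (div_nonneg_of_nonpos (by norm_num) (by linarith))
  · refine ⟨Real.toNNReal (6 * κ * (3 ^ γ / γ)) + 1, fun u => ?_⟩
    rcases eq_or_ne (∫⁻ y, u y) ∞ with hU | hU
    · rw [hU, ENNReal.mul_top (by simp)]; exact le_top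
    refine lintegral_lintegral_cutPow_Icc_le_of_cover hκ (fun r => r) (fun b _ => 3 * κ * b)
      (fun b => Iio (3 * b)) (fun b => by fun_prop) (fun b => measurableSet_Iio)
      (fun r hr => hr.le) (fun b hb r hr h => ?_) (fun b hb => ?_)
      (R := (∫⁻ y, u y).toReal ^ (1 / (1 + γ))) (fun r hr h => ?_)
    · exact ⟨show r < 3 * b by linarith, by nlinarith⟩
    · calc ∫⁻ r in Iio (3 * b) ∩ Ioi 0, ENNReal.ofReal (2 * (3 * κ * b)) *
              ENNReal.ofReal (r ^ (γ - 1))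
          = ENNReal.ofReal (6 * κ * (3 ^ γ / γ)) * ENNReal.ofReal (b ^ (1 + γ)) := by
            rw [Iio_inter_Ioi, lintegral_const_mul _ (by fun_prop), lintegral_Ioo_rpow hγ
              (by positivity), Real.mul_rpow (by norm_num) hb.le,
              ← ENNReal.ofReal_mul (by positivity), ← ENNReal.ofReal_mul (by positivity),
              add_comm 1 γ, Real.rpow_add_one hb.ne']
            congr 1; ring
        _ ≤ _ := by
            gcongr
            rw [ENNReal.coe_add]
            exact le_self_add
    · rw [ENNReal.ofReal_le_iff_le_toReal hU] at h
      calc r = (r ^ (1 + γ)) ^ (1 / (1 + γ)) := by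
            rw [← Real.rpow_mul hr.le, mul_div_cancel₀ _ (by linarith), Real.rpow_one]
        _ ≤ _ := Real.rpow_le_rpow (by positivity) h (by positivity)

/-- The weak-type estimate for averages over one-sided intervals. -/
lemma lintegral_cutPow_Icc_rpow_le {κ γ p : ℝ} (hκ : 0 < κ) (hp : 1 ≤ p) (hγ : γ ∈ Gam p 1) :
    ∃ C : ℝ≥0, ∀ u : ℝ → ℝ≥0∞, Measurable u →
      ∫⁻ t, (∫⁻ r in Ioi 0, cutPow (1 + γ) γ (∫⁻ y in Icc t (t + κ * r), u y) r) ^ p ≤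
        C * ∫⁻ y, u y ^ p := by
  rcases hp.eq_or_lt with rfl | hp
  · have : γ < -1 ∨ 0 < γ := by simpa [Gam] using hγ
    obtain ⟨C, hC⟩ := lintegral_lintegral_cutPow_Icc_le hκ this
    exact ⟨C, fun u _ => by simpa using hC u⟩
  · have hγ0 : γ ≠ 0 := by simpa [Gam, hp.ne'] using hγ
    obtain ⟨C, hC⟩ := lintegral_dyadicMax_rpow_le hp
    have hp0 : 0 < p := by linarith
    refine ⟨Real.toNNReal ((2 * κ / |γ|) ^ p) * C, fun u hu => ?_⟩
    have key : ∀ t, ∫⁻ r in Ioi 0, cutPow (1 + γ) γ (∫⁻ y in Icc t (t + κ * r), u y) r ≤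
        ENNReal.ofReal (2 * κ / |γ|) * dyadicMax u t := by
      intro t
      calc ∫⁻ r in Ioi 0, cutPow (1 + γ) γ (∫⁻ y in Icc t (t + κ * r), u y) r
          ≤ ∫⁻ r in Ioi 0, cutPow γ γ (ENNReal.ofReal (2 * κ) * dyadicMax u t) r := by
            refine setLIntegral_mono' measurableSet_Ioi fun r (hr : 0 < r) => ?_
            unfold cutPow
            split_ifs with h1 h2
            · exact le_rfl
            · refine absurd ?_ h2
              have h3 := h1.trans_le (lintegral_Icc_le_dyadicMax u t (mul_pos hκ hr))
              rw [Real.rpow_add hr, Real.rpow_one, ENNReal.ofReal_mul hr.le,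
                show 2 * (κ * r) = r * (2 * κ) by ring, ENNReal.ofReal_mul hr.le, mul_assoc] at h3
              exact lt_of_mul_lt_mul_left' h3
            · exact zero_le
            · exact le_rfl
        _ = _ := by
            rw [lintegral_cutPow hγ0, ENNReal.ofReal_div_of_pos (abs_pos.2 hγ0),
              ENNReal.mul_div_right_comm]
    calc ∫⁻ t, (∫⁻ r in Ioi 0, cutPow (1 + γ) γ (∫⁻ y in Icc t (t + κ * r), u y) r) ^ p
        ≤ ∫⁻ t, ENNReal.ofReal ((2 * κ / |γ|) ^ p) * dyadicMax u t ^ p := by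
          refine lintegral_mono fun t => ?_
          rw [← ENNReal.ofReal_rpow_of_nonneg (by positivity) hp0.le,
            ← ENNReal.mul_rpow_of_nonneg _ _ hp0.le]
          exact ENNReal.rpow_le_rpow (key t) hp0.le
      _ ≤ _ := by
          rw [lintegral_const_mul _ ((measurable_dyadicMax hu).pow_const p), ENNReal.coe_mul,
            mul_assoc]
          gcongr
          · exact le_rfl
          · exact hC u hu

lemma lintegral_lintegral_cutPow_add {γ : ℝ} (hγ : γ ≠ 0) {u : ℝ → ℝ≥0∞} (hu : Measurable u) :
    ∫⁻ t, ∫⁻ r in Ioi 0, cutPow γ γ (u (t + r)) r = (∫⁻ y, u y) / ENNReal.ofReal |γ| := by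
  have m1 : Measurable fun z : ℝ × ℝ => cutPow γ γ (u (z.1 + z.2)) z.2 :=
    measurable_cutPow _ _ (hu.comp (by fun_prop)) measurable_snd
  have m2 : Measurable fun z : ℝ × ℝ => cutPow γ γ (u z.1) z.2 :=
    measurable_cutPow _ _ (hu.comp (by fun_prop)) measurable_snd
  rw [lintegral_lintegral_swap (f := fun t r => cutPow γ γ (u (t + r)) r) m1.aemeasurable]
  have : ∀ r, ∫⁻ t, cutPow γ γ (u (t + r)) r = ∫⁻ t, cutPow γ γ (u t) r := fun r =>
    lintegral_add_right_eq_self (fun t => cutPow γ γ (u t) r) r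
  simp_rw [this]
  rw [← lintegral_lintegral_swap (f := fun t r => cutPow γ γ (u t) r) m2.aemeasurable]
  simp_rw [lintegral_cutPow hγ]
  simp_rw [div_eq_mul_inv]
  rw [lintegral_mul_const _ hu]

lemma lintegral_cutPow_add_rpow_le {γ p : ℝ} (hp : 1 ≤ p) (hγ : γ ≠ 0) :
    ∃ C : ℝ≥0, ∀ u : ℝ → ℝ≥0∞, Measurable u →
      ∫⁻ t, (∫⁻ r in Ioi 0, cutPow γ γ (u (t + r)) r) ^ p ≤ C * ∫⁻ y, u y ^ p := by
  have hγ' : 0 < |γ| := abs_pos.2 hγ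
  rcases hp.eq_or_lt with rfl | hp
  · refine ⟨Real.toNNReal |γ|⁻¹, fun u hu => ?_⟩
    simp only [ENNReal.rpow_one]
    rw [lintegral_lintegral_cutPow_add hγ hu, div_eq_mul_inv, mul_comm,
      ← ENNReal.ofReal_inv_of_pos hγ']
    rfl
  · refine ⟨Real.toNNReal (p / (p - 1) / (|γ| / 2) ^ (p - 1)) * Real.toNNReal (2 * |γ|⁻¹),
      fun u hu => ?_⟩
    have m1 : Measurable fun z : ℝ × ℝ => cutPow γ γ (u (z.1 + z.2)) z.2 :=
      measurable_cutPow _ _ (hu.comp (by fun_prop)) measurable_snd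
    have := lintegral_rpow_le_of_weak (μ := volume) hp (c := |γ| / 2) (by positivity)
      (C := ENNReal.ofReal (2 * |γ|⁻¹)) hu m1.lintegral_prod_right' fun l hl => by
        set c := ENNReal.ofReal (|γ| / 2 * l) with hc
        have hms := measurableSet_lt (measurable_const (a := c)) hu
        set w := {x | c < u x}.indicator u with hw
        have hwm : Measurable w := hu.indicator hms
        have mw : Measurable fun z : ℝ × ℝ => cutPow γ γ (w (z.1 + z.2)) z.2 :=
          measurable_cutPow _ _ (hwm.comp (by fun_prop)) measurable_snd
        have hsplit : ∀ t, ∫⁻ r in Ioi 0, cutPow γ γ (u (t + r)) r ≤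
            (∫⁻ r in Ioi 0, cutPow γ γ (w (t + r)) r) + ENNReal.ofReal (1 / 2 * l) := by
          intro t
          have h1 : ENNReal.ofReal (1 / 2 * l) = ∫⁻ r in Ioi 0, cutPow γ γ c r := by
            rw [lintegral_cutPow hγ, hc, ← ENNReal.ofReal_div_of_pos hγ']
            congr 1; field_simp
          have m2 : Measurable fun r => cutPow γ γ (w (t + r)) r := mw.comp measurable_prodMk_left
          rw [h1, ← lintegral_add_left m2]
          exact lintegral_mono fun r => (cutPow_mono _ _ (le_indicator_add u c _) _).trans
            (cutPow_max_le _ _ _ _ _)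
        rw [← lintegral_indicator hms, two_mul_ofReal_half]
        calc 2 * ENNReal.ofReal (1 / 2 * l) * volume {t | 2 * ENNReal.ofReal (1 / 2 * l) <
                ∫⁻ r in Ioi 0, cutPow γ γ (u (t + r)) r}
            ≤ 2 * ENNReal.ofReal (1 / 2 * l) * volume {t | ENNReal.ofReal (1 / 2 * l) ≤
                ∫⁻ r in Ioi 0, cutPow γ γ (w (t + r)) r} := by
              refine mul_le_mul_right (measure_mono fun t ht => ?_) _
              rw [mem_ofPred_eq, ← two_mul_ofReal_half] at ht
              exact (lt_half_of_lt_add_half (ht.trans_le (hsplit t))).le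
          _ ≤ 2 * ∫⁻ t, ∫⁻ r in Ioi 0, cutPow γ γ (w (t + r)) r := by
              rw [mul_assoc]
              refine mul_le_mul_right ?_ _
              exact mul_meas_ge_le_lintegral mw.lintegral_prod_right' _
          _ = ENNReal.ofReal (2 * |γ|⁻¹) * ∫⁻ y, w y := by
              rw [lintegral_lintegral_cutPow_add hγ hwm, ENNReal.ofReal_mul zero_le_two,
                ENNReal.ofReal_inv_of_pos hγ', ENNReal.ofReal_ofNat, div_eq_mul_inv]
              ring
    refine this.trans (le_of_eq ?_)
    rw [ENNReal.coe_mul]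
    rfl

lemma lintegral_rpow_le_measure_univ_mul {X : Type*} [MeasurableSpace X] (μ : Measure X)
    [IsFiniteMeasure μ] {p : ℝ} (hp : 1 ≤ p) {f : X → ℝ≥0∞} (hf : Measurable f) :
    (∫⁻ x, f x ∂μ) ^ p ≤ μ univ ^ (p - 1) * ∫⁻ x, f x ^ p ∂μ := by
  have hp0 : 0 < p := by linarith
  have h := eLpNorm'_le_eLpNorm'_mul_rpow_measure_univ (μ := μ) one_pos hp
    hf.aestronglyMeasurable
  simp only [eLpNorm', enorm_eq_self, ENNReal.rpow_one, div_one] at h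
  calc (∫⁻ x, f x ∂μ) ^ p
      ≤ ((∫⁻ x, f x ^ p ∂μ) ^ (1 / p) * μ univ ^ (1 - 1 / p)) ^ p := by gcongr
    _ = _ := by
      rw [ENNReal.mul_rpow_of_nonneg _ _ hp0.le, ← ENNReal.rpow_mul, ← ENNReal.rpow_mul, mul_comm,
        one_div_mul_cancel hp0.ne', ENNReal.rpow_one]
      congr 2
      field_simp

lemma lintegral_eq_lintegral_sphere {n : ℕ} (hn : 0 < n) {F : En n → ℝ≥0∞} (hF : Measurable F) :
    ∫⁻ h, F h = ∫⁻ θ : Metric.sphere (0 : En n) 1, (∫⁻ r in Ioi (0 : ℝ),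
      F (r • (θ : En n)) * ENNReal.ofReal (r ^ (n - 1))) ∂(volume : Measure (En n)).toSphere := by
  have : Nonempty (Fin n) := ⟨⟨0, hn⟩⟩
  have h := (volume : Measure (En n)).measurePreserving_homeomorphUnitSphereProd
  have hd : Module.finrank ℝ (En n) = n := by simp
  rw [hd] at h
  have h2 := h.symm (homeomorphUnitSphereProd (En n)).toMeasurableEquiv
  have h3 : ∫⁻ z : ({0}ᶜ : Set (En n)), F z ∂(volume.comap (Subtype.val)) = ∫⁻ h, F h := by
    rw [lintegral_subtype_comap (measurableSet_singleton _).compl, restrict_compl_singleton]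
  rw [← h3, ← h2.lintegral_comp_emb
    (homeomorphUnitSphereProd (En n)).toMeasurableEquiv.symm.measurableEmbedding,
    lintegral_prod]
  · refine lintegral_congr fun θ => ?_
    rw [Measure.volumeIoiPow, lintegral_withDensity_eq_lintegral_mul₀]
    · simp only [Pi.mul_apply]
      rw [← lintegral_subtype_comap measurableSet_Ioi
        (fun r : ℝ => F (r • (θ : En n)) * ENNReal.ofReal (r ^ (n - 1)))]
      refine lintegral_congr fun r => ?_
      rw [mul_comm]
      rfl
    · fun_prop
    · refine Measurable.aemeasurable (hF.comp ?_)
      exact measurable_subtype_coe.comp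
        ((homeomorphUnitSphereProd (En n)).toMeasurableEquiv.symm.measurable.comp
          measurable_prodMk_left)
  · exact (hF.comp (measurable_subtype_coe.comp
      (homeomorphUnitSphereProd (En n)).toMeasurableEquiv.symm.measurable)).aemeasurable

lemma lintegral_eq_lintegral_strip {n : ℕ} {θ : En n} (hθ : ‖θ‖ = 1) {F : En n → ℝ≥0∞}
    (hF : Measurable F) :
    ∫⁻ x, F x = ∫⁻ x, (Ico (0 : ℝ) 1).indicator 1 (inner ℝ x θ) * ∫⁻ t : ℝ, F (x + t • θ) := by
  set w : En n → ℝ≥0∞ := fun x => (Ico (0 : ℝ) 1).indicator 1 (inner ℝ x θ) with hw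
  have mw : Measurable w := by
    refine (measurable_one.indicator measurableSet_Ico).comp ?_
    fun_prop
  have h1 : ∀ x, ∫⁻ t : ℝ, w (x - t • θ) = 1 := by
    intro x
    have : ∀ t : ℝ, w (x - t • θ) = (Ico (0 : ℝ) 1).indicator 1 (inner ℝ x θ - t) := by
      intro t
      simp only [hw, inner_sub_left, real_inner_smul_left, real_inner_self_eq_norm_sq, hθ]
      simp
    simp only [this]
    rw [lintegral_sub_left_eq_self (fun t => (Ico (0 : ℝ) 1).indicator 1 t) (inner ℝ x θ),
      lintegral_indicator_one measurableSet_Ico]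
    simp
  calc ∫⁻ x, F x = ∫⁻ x, ∫⁻ t : ℝ, w (x - t • θ) * F x := by
        refine lintegral_congr fun x => ?_
        have m : Measurable fun t : ℝ => w (x - t • θ) := mw.comp (by fun_prop)
        rw [lintegral_mul_const _ m, h1, one_mul]
    _ = ∫⁻ t : ℝ, ∫⁻ x, w (x - t • θ) * F x := by
        refine lintegral_lintegral_swap (Measurable.aemeasurable ?_)
        exact (mw.comp (by fun_prop)).mul (hF.comp measurable_fst)
    _ = ∫⁻ t : ℝ, ∫⁻ x, w x * F (x + t • θ) := by
        refine lintegral_congr fun t => ?_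
        rw [← lintegral_add_right_eq_self (fun x => w (x - t • θ) * F x) (t • θ)]
        simp
    _ = ∫⁻ x, ∫⁻ t : ℝ, w x * F (x + t • θ) := by
        refine lintegral_lintegral_swap (Measurable.aemeasurable ?_)
        exact (mw.comp measurable_snd).mul (hF.comp (by fun_prop))
    _ = _ := by
        refine lintegral_congr fun x => ?_
        have m : Measurable fun t : ℝ => F (x + t • θ) := hF.comp (by fun_prop)
        exact lintegral_const_mul _ m

lemma lintegral_le_of_lines {n : ℕ} {θ : En n} (hθ : ‖θ‖ = 1) {F V : En n → ℝ≥0∞}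
    (hF : Measurable F) (hV : Measurable V) {C : ℝ≥0∞}
    (h : ∀ x, ∫⁻ t : ℝ, F (x + t • θ) ≤ C * ∫⁻ t : ℝ, V (x + t • θ)) :
    ∫⁻ x, F x ≤ C * ∫⁻ x, V x := by
  rw [lintegral_eq_lintegral_strip hθ hF, lintegral_eq_lintegral_strip hθ hV,
    ← lintegral_const_mul]
  · refine lintegral_mono fun x => ?_
    rw [mul_left_comm]
    exact mul_le_mul_right (h x) _
  · refine Measurable.mul ?_ ?_
    · exact (measurable_one.indicator measurableSet_Ico).comp (by fun_prop)
    · refine Measurable.lintegral_prod_right' (f := fun z : En n × ℝ => V (z.1 + z.2 • θ)) ?_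
      exact hV.comp (by fun_prop)

lemma lintegral_rpow_lintegral_le_of_lines {n : ℕ} (hn : 0 < n) {p : ℝ} (hp : 1 ≤ p)
    (C : ℝ≥0) : ∃ C' : ℝ≥0, ∀ (W : En n × En n → ℝ≥0∞) (V : En n → ℝ≥0∞),
      Measurable W → Measurable V →
      (∀ θ : En n, ‖θ‖ = 1 → ∀ x, ∫⁻ t : ℝ, (∫⁻ r in Ioi (0 : ℝ),
        W (x + t • θ, r • θ) * ENNReal.ofReal (r ^ (n - 1))) ^ p ≤ C * ∫⁻ t : ℝ, V (x + t • θ)) →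
      ∫⁻ x, (∫⁻ h, W (x, h)) ^ p ≤ C' * ∫⁻ x, V x := by
  set σ := (volume : Measure (En n)).toSphere with hσ
  have hfin : σ univ ^ (p - 1) * (C * σ univ) ≠ ∞ :=
    ENNReal.mul_ne_top (ENNReal.rpow_ne_top_of_nonneg (by linarith) (measure_ne_top _ _))
      (ENNReal.mul_ne_top ENNReal.coe_ne_top (measure_ne_top _ _))
  refine ⟨(σ univ ^ (p - 1) * (C * σ univ)).toNNReal, fun W V hW hV hline => ?_⟩
  rw [ENNReal.coe_toNNReal hfin]
  set R : En n → En n → ℝ≥0∞ := fun x θ =>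
    ∫⁻ r in Ioi (0 : ℝ), W (x, r • θ) * ENNReal.ofReal (r ^ (n - 1)) with hR
  have mR : Measurable fun z : En n × En n => R z.1 z.2 := by
    refine Measurable.lintegral_prod_right' (ν := volume.restrict (Ioi (0 : ℝ)))
      (f := fun z : (En n × En n) × ℝ =>
      W (z.1.1, z.2 • z.1.2) * ENNReal.ofReal (z.2 ^ (n - 1))) ?_
    exact (hW.comp (by fun_prop)).mul (by fun_prop)
  have mRs : Measurable fun z : En n × Metric.sphere (0 : En n) 1 => R z.1 z.2 :=
    mR.comp (measurable_fst.prodMk (measurable_subtype_coe.comp measurable_snd))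
  calc ∫⁻ x, (∫⁻ h, W (x, h)) ^ p
      = ∫⁻ x, (∫⁻ θ : Metric.sphere (0 : En n) 1, R x θ ∂σ) ^ p := by
        refine lintegral_congr fun x => ?_
        have m : Measurable fun h => W (x, h) := hW.comp measurable_prodMk_left
        rw [lintegral_eq_lintegral_sphere hn m]
    _ ≤ ∫⁻ x, σ univ ^ (p - 1) * ∫⁻ θ : Metric.sphere (0 : En n) 1, R x θ ^ p ∂σ :=
        lintegral_mono fun x => lintegral_rpow_le_measure_univ_mul σ hp
          (mRs.comp measurable_prodMk_left)
    _ = σ univ ^ (p - 1) * ∫⁻ θ : Metric.sphere (0 : En n) 1, (∫⁻ x : En n, R x θ ^ p) ∂σ := by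
        have m : Measurable fun x => ∫⁻ θ : Metric.sphere (0 : En n) 1, R x θ ^ p ∂σ :=
          Measurable.lintegral_prod_right' (mRs.pow_const p)
        rw [lintegral_const_mul _ m, lintegral_lintegral_swap (f := fun x
          (θ : Metric.sphere (0 : En n) 1) => R x θ ^ p) (mRs.pow_const p).aemeasurable]
    _ ≤ σ univ ^ (p - 1) * ∫⁻ _ : Metric.sphere (0 : En n) 1, (C * ∫⁻ x, V x) ∂σ := by
        refine mul_le_mul_right (lintegral_mono fun θ => ?_) _
        have hθ : ‖(θ : En n)‖ = 1 := by simp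
        exact lintegral_le_of_lines hθ ((mR.comp measurable_prodMk_right).pow_const p) hV
          (hline θ hθ)
    _ = _ := by
        rw [lintegral_const]
        ring

lemma lintegral_rpow_lintegral_cutPow_le_of_lines {n : ℕ} (hn : 0 < n) {p : ℝ} (hp : 1 ≤ p)
    (γ : ℝ) (C : ℝ≥0) : ∃ C' : ℝ≥0, ∀ (a : En n × En n → ℝ≥0∞) (V : En n → ℝ≥0∞),
      Measurable a → Measurable V →
      (∀ θ : En n, ‖θ‖ = 1 → ∀ x, ∫⁻ t : ℝ, (∫⁻ r in Ioi (0 : ℝ),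
        cutPow γ γ (a (x + t • θ, r • θ)) r) ^ p ≤ C * ∫⁻ t : ℝ, V (x + t • θ)) →
      ∫⁻ x, (∫⁻ h, cutPow γ (γ - n + 1) (a (x, h)) ‖h‖) ^ p ≤ C' * ∫⁻ x, V x := by
  obtain ⟨C', hC'⟩ := lintegral_rpow_lintegral_le_of_lines hn hp C
  refine ⟨C', fun a V ha hV h => hC' (fun z => cutPow γ (γ - n + 1) (a z) ‖z.2‖) V
    (measurable_cutPow _ _ ha (by fun_prop)) hV fun θ hθ x => ?_⟩
  refine le_of_eq_of_le ?_ (h θ hθ x)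
  refine lintegral_congr fun t => ?_
  congr 1
  refine setLIntegral_congr_fun measurableSet_Ioi fun r (hr : 0 < r) => ?_
  simp only [cutPow, norm_smul, hθ, Real.norm_of_nonneg hr.le, mul_one]
  split_ifs
  · rw [← ENNReal.ofReal_mul (Real.rpow_nonneg hr.le _), ← Real.rpow_natCast,
      ← Real.rpow_add hr]
    congr 2
    have : ((n - 1 : ℕ) : ℝ) = n - 1 := by rw [Nat.cast_sub hn]; simp
    rw [this]
    ring
  · simp

lemma setLIntegral_Icc_add_mul {u : ℝ → ℝ≥0∞} {r : ℝ} (hr : 0 < r) (t κ : ℝ) :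
    ∫⁻ y in Icc t (t + κ * r), u y = ENNReal.ofReal r * ∫⁻ τ in Icc 0 κ, u (t + τ * r) := by
  have h1 : ∀ F : ℝ → ℝ≥0∞, ∫⁻ y, F y = ENNReal.ofReal r * ∫⁻ τ, F (t + τ * r) := by
    intro F
    rw [← lintegral_add_left_eq_self F t]
    conv_lhs => rw [← Real.smul_map_volume_mul_right hr.ne']
    rw [lintegral_smul_measure, abs_of_pos hr, smul_eq_mul,
      (measurableEmbedding_mulRight₀ hr.ne').lintegral_map]
  rw [← lintegral_indicator measurableSet_Icc, h1, ← lintegral_indicator measurableSet_Icc]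
  congr 2
  ext τ
  simp only [indicator_apply, mem_Icc]
  congr 1
  simp only [eq_iff_iff]
  constructor
  · rintro ⟨ha, hb⟩
    exact ⟨by nlinarith, by nlinarith⟩
  · rintro ⟨ha, hb⟩
    exact ⟨by nlinarith, by nlinarith⟩

lemma lintegral_cutPow_segment_le {n : ℕ} (hn : 0 < n) {κ γ p : ℝ} (hκ : 0 < κ) (hp : 1 ≤ p)
    (hγ : γ ∈ Gam p 1) : ∃ C : ℝ≥0, ∀ G : En n → ℝ≥0∞, Measurable G →
      ∫⁻ x, (∫⁻ h, cutPow γ (γ - n + 1) (∫⁻ t in Icc 0 κ, G (x + t • h)) ‖h‖) ^ p ≤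
        C * ∫⁻ x, G x ^ p := by
  obtain ⟨C, hC⟩ := lintegral_cutPow_Icc_rpow_le hκ hp hγ
  obtain ⟨C', hC'⟩ := lintegral_rpow_lintegral_cutPow_le_of_lines hn hp γ C
  refine ⟨C', fun G hG => hC' (fun z => ∫⁻ t in Icc 0 κ, G (z.1 + t • z.2)) _ ?_
    (hG.pow_const p) fun θ hθ x => ?_⟩
  · refine Measurable.lintegral_prod_right' (ν := volume.restrict (Icc 0 κ))
      (f := fun z : (En n × En n) × ℝ => G (z.1.1 + z.2 • z.1.2)) ?_
    exact hG.comp (by fun_prop)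
  · refine le_of_eq_of_le ?_ (hC (fun t => G (x + t • θ)) (hG.comp (by fun_prop)))
    refine lintegral_congr fun t => ?_
    congr 1
    refine setLIntegral_congr_fun measurableSet_Ioi fun r (hr : 0 < r) => ?_
    simp only [cutPow, setLIntegral_Icc_add_mul (u := fun t => G (x + t • θ)) hr]
    simp only [Real.rpow_add hr, Real.rpow_one, ENNReal.ofReal_mul hr.le]
    simp only [ENNReal.mul_lt_mul_iff_right (ENNReal.ofReal_pos.2 hr).ne' ENNReal.ofReal_ne_top,
      smul_smul, add_smul, add_assoc]

lemma lintegral_cutPow_translate_le {n : ℕ} (hn : 0 < n) {γ p : ℝ} (hp : 1 ≤ p) (hγ : γ ≠ 0) :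
    ∃ C : ℝ≥0, ∀ G : En n → ℝ≥0∞, Measurable G →
      ∫⁻ x, (∫⁻ h, cutPow γ (γ - n + 1) (G (x + h)) ‖h‖) ^ p ≤ C * ∫⁻ x, G x ^ p := by
  obtain ⟨C, hC⟩ := lintegral_cutPow_add_rpow_le hp hγ
  obtain ⟨C', hC'⟩ := lintegral_rpow_lintegral_cutPow_le_of_lines hn hp γ C
  refine ⟨C', fun G hG => hC' (fun z => G (z.1 + z.2)) _ (hG.comp (by fun_prop))
    (hG.pow_const p) fun θ hθ x => ?_⟩
  refine le_of_eq_of_le ?_ (hC (fun t => G (x + t • θ)) (hG.comp (by fun_prop)))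
  simp only [add_smul, add_assoc]

lemma lintegral_cutPow_self_le {n : ℕ} (hn : 0 < n) {γ p : ℝ} (hp : 1 ≤ p) (hγ : γ ≠ 0) :
    ∃ C : ℝ≥0, ∀ G : En n → ℝ≥0∞, Measurable G →
      ∫⁻ x, (∫⁻ h : En n, cutPow γ (γ - n + 1) (G x) ‖h‖) ^ p ≤ C * ∫⁻ x, G x ^ p := by
  have hγ' : 0 < |γ| := abs_pos.2 hγ
  obtain ⟨C', hC'⟩ := lintegral_rpow_lintegral_cutPow_le_of_lines hn hp γ
    (((ENNReal.ofReal |γ|)⁻¹ ^ p).toNNReal)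
  refine ⟨C', fun G hG => hC' (fun z => G z.1) _ (hG.comp measurable_fst)
    (hG.pow_const p) fun θ hθ x => ?_⟩
  simp only [lintegral_cutPow hγ]
  have m : Measurable fun t : ℝ => G (x + t • θ) ^ p := (hG.comp (by fun_prop)).pow_const p
  rw [ENNReal.coe_toNNReal (ENNReal.rpow_ne_top_of_nonneg (by linarith)
    (ENNReal.inv_ne_top.2 (ENNReal.ofReal_pos.2 hγ').ne')), ← lintegral_const_mul _ m]
  refine lintegral_mono fun t => ?_
  rw [← ENNReal.mul_rpow_of_nonneg _ _ (by linarith), ENNReal.div_eq_inv_mul]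

section Derivatives

variable {n : ℕ}

lemma contDiff_pd {ψ : En n → ℝ} (hψ : ContDiff ℝ (⊤ : ℕ∞) ψ) (i : Fin n) :
    ContDiff ℝ (⊤ : ℕ∞) (pd i ψ) :=
  ((contDiff_infty_iff_fderiv.1 hψ).2).clm_apply contDiff_const

lemma HasCompactSupport.pd {ψ : En n → ℝ} (hψ : HasCompactSupport ψ) (i : Fin n) :
    HasCompactSupport (pd i ψ) :=
  hψ.fderiv_apply (𝕜 := ℝ) _

lemma pd_comm {ψ : En n → ℝ} (hψ : ContDiff ℝ (⊤ : ℕ∞) ψ) (i j : Fin n) :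
    pd i (pd j ψ) = pd j (pd i ψ) := by
  have hd : Differentiable ℝ (fderiv ℝ ψ) :=
    (contDiff_infty_iff_fderiv.1 hψ).2.differentiable (by simp)
  have key : ∀ (a b : Fin n) (x : En n), pd a (pd b ψ) x =
      fderiv ℝ (fderiv ℝ ψ) x (EuclideanSpace.single a 1) (EuclideanSpace.single b 1) := by
    intro a b x
    unfold pd
    rw [fderiv_clm_apply (hd x) (differentiableAt_const _)]
    simp
  ext x
  rw [key, key]
  have hs : IsSymmSndFDerivAt ℝ ψ x := hψ.contDiffAt.isSymmSndFDerivAt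
    (by simpa using WithTop.coe_le_coe.2 (le_top : (2 : ℕ∞) ≤ ⊤))
  exact hs _ _

lemma contDiff_iterate_pd {ψ : En n → ℝ} (hψ : ContDiff ℝ (⊤ : ℕ∞) ψ) (i : Fin n) (a : ℕ) :
    ContDiff ℝ (⊤ : ℕ∞) ((pd i)^[a] ψ) := by
  induction a with
  | zero => exact hψ
  | succ a ih => rw [Function.iterate_succ_apply']; exact contDiff_pd ih i

lemma pd_iterate_pd_comm {ψ : En n → ℝ} (hψ : ContDiff ℝ (⊤ : ℕ∞) ψ) (i j : Fin n) (a : ℕ) :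
    pd j ((pd i)^[a] ψ) = (pd i)^[a] (pd j ψ) := by
  induction a with
  | zero => rfl
  | succ a ih =>
    rw [Function.iterate_succ_apply', Function.iterate_succ_apply',
      pd_comm (contDiff_iterate_pd hψ i a), ih]

lemma contDiff_foldr_pd {ψ : En n → ℝ} (hψ : ContDiff ℝ (⊤ : ℕ∞) ψ) (α : Fin n → ℕ)
    (l : List (Fin n)) : ContDiff ℝ (⊤ : ℕ∞) (l.foldr (fun i ψ => (pd i)^[α i] ψ) ψ) := by
  induction l with
  | nil => exact hψ
  | cons i l ih => exact contDiff_iterate_pd ih i _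

lemma pd_foldr_pd {ψ : En n → ℝ} (hψ : ContDiff ℝ (⊤ : ℕ∞) ψ) (α : Fin n → ℕ) (j : Fin n)
    {l : List (Fin n)} (hl : l.Nodup) (hj : j ∈ l) :
    pd j (l.foldr (fun i ψ => (pd i)^[α i] ψ) ψ) =
      l.foldr (fun i ψ => (pd i)^[(α + Pi.single j 1 : Fin n → ℕ) i] ψ) ψ := by
  induction l with
  | nil => simp at hj
  | cons i l ih =>
    rw [List.nodup_cons] at hl
    simp only [List.foldr_cons]
    rcases eq_or_ne j i with rfl | hij
    · rw [← Function.iterate_succ_apply' (pd j)]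
      have h1 : (α + Pi.single j 1 : Fin n → ℕ) j = (α j).succ := by simp
      have h2 : l.foldr (fun i ψ => (pd i)^[(α + Pi.single j 1 : Fin n → ℕ) i] ψ) ψ =
          l.foldr (fun i ψ => (pd i)^[α i] ψ) ψ := by
        refine List.foldr_ext _ _ _ fun i hi χ => ?_
        have : i ≠ j := fun h => hl.1 (h ▸ hi)
        simp [this]
      rw [h1, h2]
    · have hj' : j ∈ l := by simpa [hij] using hj
      rw [pd_iterate_pd_comm (contDiff_foldr_pd hψ α l), ih hl.2 hj']
      simp [hij.symm]

lemma contDiff_mpd {ψ : En n → ℝ} (hψ : ContDiff ℝ (⊤ : ℕ∞) ψ) (α : Fin n → ℕ) :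
    ContDiff ℝ (⊤ : ℕ∞) (mpd α ψ) := contDiff_foldr_pd hψ α _

lemma pd_mpd {ψ : En n → ℝ} (hψ : ContDiff ℝ (⊤ : ℕ∞) ψ) (α : Fin n → ℕ) (j : Fin n) :
    pd j (mpd α ψ) = mpd (α + Pi.single j 1) ψ :=
  pd_foldr_pd hψ α j (List.nodup_finRange n) (List.mem_finRange j)

lemma mpd_zero (ψ : En n → ℝ) : mpd 0 ψ = ψ := by
  unfold mpd
  induction List.finRange n with
  | nil => rfl
  | cons i l ih => simp

/-- The multi-index counting how often each coordinate occurs in a word. -/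
noncomputable def wordIndex {m : ℕ} (w : Fin m → Fin n) : Fin n → ℕ := ∑ j, Pi.single (w j) 1

lemma sum_wordIndex {m : ℕ} (w : Fin m → Fin n) : ∑ i, wordIndex w i = m := by
  simp only [wordIndex, Finset.sum_apply]
  rw [Finset.sum_comm]
  simp

/-- The derivative of `ψ` in direction `h`. -/
noncomputable def dirDeriv (h : En n) (ψ : En n → ℝ) : En n → ℝ := fun x => fderiv ℝ ψ x h

lemma contDiff_dirDeriv {ψ : En n → ℝ} (hψ : ContDiff ℝ (⊤ : ℕ∞) ψ) (h : En n) :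
    ContDiff ℝ (⊤ : ℕ∞) (dirDeriv h ψ) :=
  ((contDiff_infty_iff_fderiv.1 hψ).2).clm_apply contDiff_const

lemma contDiff_iterate_dirDeriv {ψ : En n → ℝ} (hψ : ContDiff ℝ (⊤ : ℕ∞) ψ) (h : En n) (m : ℕ) :
    ContDiff ℝ (⊤ : ℕ∞) ((dirDeriv h)^[m] ψ) := by
  induction m with
  | zero => exact hψ
  | succ m ih => rw [Function.iterate_succ_apply']; exact contDiff_dirDeriv ih h

lemma hasCompactSupport_iterate_dirDeriv {ψ : En n → ℝ} (hψ : HasCompactSupport ψ) (h : En n)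
    (m : ℕ) : HasCompactSupport ((dirDeriv h)^[m] ψ) := by
  induction m with
  | zero => exact hψ
  | succ m ih => rw [Function.iterate_succ_apply']; exact ih.fderiv_apply (𝕜 := ℝ) _

lemma dirDeriv_eq_sum (h : En n) (ψ : En n → ℝ) (x : En n) :
    dirDeriv h ψ x = ∑ i, h i * pd i ψ x := by
  have : h = ∑ i, h i • EuclideanSpace.single i (1 : ℝ) := by
    ext j
    simp [Finset.sum_apply, Pi.single_apply]
  unfold dirDeriv pd
  conv_lhs => rw [this]
  simp

lemma dirDeriv_sum {ι : Type*} (s : Finset ι) (c : ι → ℝ) {ψ : ι → En n → ℝ}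
    (hψ : ∀ i, ContDiff ℝ (⊤ : ℕ∞) (ψ i)) (h : En n) :
    dirDeriv h (fun x => ∑ i ∈ s, c i * ψ i x) = fun x => ∑ i ∈ s, c i * dirDeriv h (ψ i) x := by
  ext x
  have hd : ∀ i, DifferentiableAt ℝ (ψ i) x := fun i => (hψ i).differentiable (by simp) x
  unfold dirDeriv
  rw [fderiv_fun_sum fun i _ => (hd i).const_mul (c i), _root_.sum_apply]
  refine Finset.sum_congr rfl fun i _ => ?_
  rw [fderiv_const_mul (hd i)]
  simp

lemma iterate_dirDeriv_eq_sum {ψ : En n → ℝ} (hψ : ContDiff ℝ (⊤ : ℕ∞) ψ) (h : En n) (m : ℕ) :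
    (dirDeriv h)^[m] ψ =
      fun x => ∑ w : Fin m → Fin n, (∏ j, h (w j)) * mpd (wordIndex w) ψ x := by
  induction m with
  | zero =>
    ext x
    simp [wordIndex, mpd_zero]
  | succ m ih =>
    rw [Function.iterate_succ_apply', ih, dirDeriv_sum _ _ fun w => contDiff_mpd hψ _]
    ext x
    rw [← (Fin.consEquiv fun _ => Fin n).sum_comp, Fintype.sum_prod_type, Finset.sum_comm]
    refine Finset.sum_congr rfl fun w _ => ?_
    rw [dirDeriv_eq_sum, Finset.mul_sum]
    refine Finset.sum_congr rfl fun i _ => ?_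
    rw [pd_mpd hψ]
    have : wordIndex ((Fin.consEquiv fun _ : Fin (m + 1) => Fin n) (i, w)) =
        wordIndex w + Pi.single i 1 := by
      simp [wordIndex, Fin.sum_univ_succ, add_comm]
    rw [this]
    simp only [Fin.consEquiv_apply, Fin.prod_univ_succ, Fin.cons_zero, Fin.cons_succ]
    ring

lemma iterate_dirDeriv_comp_add (h z : En n) (m : ℕ) (ψ : En n → ℝ) :
    (dirDeriv h)^[m] (fun x => ψ (x + z)) = fun x => (dirDeriv h)^[m] ψ (x + z) := by
  induction m generalizing ψ with
  | zero => rfl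
  | succ m ih =>
    rw [Function.iterate_succ_apply, Function.iterate_succ_apply, ← ih]
    congr 1
    ext x
    simp [dirDeriv, fderiv_comp_add_right]

lemma HasWeakDerivs.integral_mul_iterate_dirDeriv {m : ℕ} {f : En n → ℝ}
    {g : (Fin n → ℕ) → En n → ℝ} (hf : LocallyIntegrable f volume) (hg : HasWeakDerivs m f g)
    {ψ : En n → ℝ} (hψ : ContDiff ℝ (⊤ : ℕ∞) ψ) (hc : HasCompactSupport ψ) (h : En n) :
    ∫ x, f x * (dirDeriv h)^[m] ψ x =
      (-1) ^ m * ∑ w : Fin m → Fin n, (∏ j, h (w j)) * ∫ x, g (wordIndex w) x * ψ x := by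
  rw [iterate_dirDeriv_eq_sum hψ]
  simp only [Finset.mul_sum]
  rw [integral_finsetSum]
  · refine Finset.sum_congr rfl fun w _ => ?_
    simp only [mul_left_comm (f _)]
    rw [integral_const_mul, hg.2 _ (sum_wordIndex w) ψ hψ hc]
    ring
  · intro w _
    simp only [mul_left_comm (f _)]
    refine Integrable.const_mul ?_ _
    have h1 : HasCompactSupport (mpd (wordIndex w) ψ) := by
      unfold mpd
      induction List.finRange n with
      | nil => exact hc
      | cons i l ih =>
        simp only [List.foldr_cons]
        induction wordIndex w i with
        | zero => exact ih
        | succ a iha => rw [Function.iterate_succ_apply']; exact iha.pd i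
    exact hf.integrable_smul_right_of_hasCompactSupport (contDiff_mpd hψ _).continuous h1

end Derivatives

/-- The uniform B-spline measure of order `m`: the law of a sum of `m` independent uniform
variables on `[0, 1]`. -/
noncomputable def splineMeasure : ℕ → Measure ℝ
  | 0 => Measure.dirac 0
  | m + 1 => ((splineMeasure m).prod (volume.restrict (Icc (0 : ℝ) 1))).map fun z => z.1 + z.2

instance isProbabilityMeasure_splineMeasure (m : ℕ) : IsProbabilityMeasure (splineMeasure m) := by
  induction m with
  | zero => unfold splineMeasure; infer_instance
  | succ m ih =>
    have : IsProbabilityMeasure (volume.restrict (Icc (0 : ℝ) 1)) := ⟨by simp⟩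
    unfold splineMeasure
    exact Measure.isProbabilityMeasure_map (by fun_prop)

lemma lintegral_splineMeasure_succ (m : ℕ) {u : ℝ → ℝ≥0∞} (hu : Measurable u) :
    ∫⁻ t, u t ∂(splineMeasure (m + 1)) =
      ∫⁻ s in Icc (0 : ℝ) 1, ∫⁻ t, u (t + s) ∂(splineMeasure m) := by
  rw [splineMeasure, lintegral_map hu (by fun_prop), lintegral_prod_symm']
  exact hu.comp (by fun_prop)

lemma lintegral_splineMeasure_le {m : ℕ} (hm : 0 < m) {u : ℝ → ℝ≥0∞} (hu : Measurable u) :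
    ∫⁻ t, u t ∂(splineMeasure m) ≤ ∫⁻ t in Icc (0 : ℝ) m, u t := by
  induction m, hm using Nat.le_induction generalizing u with
  | base =>
    rw [lintegral_splineMeasure_succ 0 hu]
    simp only [splineMeasure]
    simp
  | succ m hm ih =>
    rw [lintegral_splineMeasure_succ m hu]
    calc ∫⁻ s in Icc (0 : ℝ) 1, ∫⁻ t, u (t + s) ∂(splineMeasure m)
        ≤ ∫⁻ _ in Icc (0 : ℝ) 1, ∫⁻ t in Icc (0 : ℝ) (m + 1 : ℕ), u t := by
          refine setLIntegral_mono measurable_const fun s hs => ?_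
          refine (ih (hu.comp (measurable_add_const s))).trans ?_
          rw [← lintegral_indicator measurableSet_Icc, ← lintegral_indicator measurableSet_Icc]
          conv_rhs => rw [← lintegral_add_right_eq_self _ s]
          refine lintegral_mono fun t => ?_
          simp only [indicator_apply, mem_Icc, Function.comp]
          split_ifs with h1 h2
          · exact le_rfl
          · refine absurd ⟨by linarith [hs.1, h1.1], ?_⟩ h2
            push_cast
            linarith [hs.2, h1.2]
          · exact zero_le
          · exact le_rfl
      _ = _ := by simp

section Difference

variable {n : ℕ}

lemma kDiff_eq_iterate_fwdDiff (k : ℕ) (f : En n → ℝ) (h : En n) :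
    kDiff k f h = (fwdDiff h)^[k] f := by
  ext x
  rw [fwdDiff_iter_eq_sum_shift]
  simp [kDiff, ← Nat.cast_smul_eq_nsmul ℝ]

lemma kDiff_succ (k : ℕ) (f : En n → ℝ) (h x : En n) :
    kDiff (k + 1) f h x = kDiff k f h (x + h) - kDiff k f h x := by
  simp only [kDiff_eq_iterate_fwdDiff]
  rw [Function.iterate_succ_apply', fwdDiff]

lemma iterate_dirDeriv_fwdDiff {ψ : En n → ℝ} (hψ : ContDiff ℝ (⊤ : ℕ∞) ψ) (h : En n) (m : ℕ) :
    (dirDeriv h)^[m] (fwdDiff h ψ) = fwdDiff h ((dirDeriv h)^[m] ψ) := by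
  induction m with
  | zero => rfl
  | succ m ih =>
    rw [Function.iterate_succ_apply', Function.iterate_succ_apply', ih]
    set φ := (dirDeriv h)^[m] ψ with hφ
    have hd : Differentiable ℝ φ := (contDiff_iterate_dirDeriv hψ h m).differentiable (by simp)
    ext x
    have h1 : fwdDiff h φ = fun y => φ (y + h) - φ y := rfl
    have h2 : Differentiable ℝ fun y => φ (y + h) := by fun_prop
    simp only [h1, dirDeriv]
    rw [fderiv_fun_sub (h2 x) (hd x), fderiv_comp_add_right]
    rfl

lemma fwdDiff_eq_integral {φ : En n → ℝ} (hφ : ContDiff ℝ (⊤ : ℕ∞) φ) (h x : En n) :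
    fwdDiff h φ x = ∫ s in Icc (0 : ℝ) 1, dirDeriv h φ (x + s • h) := by
  have hd : Differentiable ℝ φ := hφ.differentiable (by simp)
  have hcont : Continuous (dirDeriv h φ) := (contDiff_dirDeriv hφ h).continuous
  rw [integral_Icc_eq_integral_Ioc, ← intervalIntegral.integral_of_le zero_le_one,
    intervalIntegral.integral_eq_sub_of_hasDerivAt (f := fun s => φ (x + s • h))]
  · simp [fwdDiff]
  · intro s _
    have h1 : HasDerivAt (fun s : ℝ => x + s • h) h s := by
      simpa using ((hasDerivAt_id s).smul_const h).const_add x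
    exact (hd (x + s • h)).hasFDerivAt.comp_hasDerivAt s h1
  · exact (hcont.comp (by fun_prop)).intervalIntegrable _ _

lemma kDiff_eq_integral_splineMeasure {ψ : En n → ℝ} (hψ : ContDiff ℝ (⊤ : ℕ∞) ψ)
    (hc : HasCompactSupport ψ) (h : En n) (m : ℕ) (x : En n) :
    kDiff m ψ h x = ∫ t, (dirDeriv h)^[m] ψ (x + t • h) ∂(splineMeasure m) := by
  rw [kDiff_eq_iterate_fwdDiff]
  induction m generalizing ψ with
  | zero => simp [splineMeasure]
  | succ m ih =>
    have hc' : HasCompactSupport (fwdDiff h ψ) := by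
      refine HasCompactSupport.sub ?_ hc
      exact hc.comp_homeomorph (Homeomorph.addRight h)
    have hs' : ContDiff ℝ (⊤ : ℕ∞) (fwdDiff h ψ) := by
      unfold fwdDiff
      exact (hψ.comp (contDiff_id.add contDiff_const)).sub hψ
    set φ := (dirDeriv h)^[m + 1] ψ with hφ
    have hφc : Continuous φ := (contDiff_iterate_dirDeriv hψ h (m + 1)).continuous
    obtain ⟨B, hB⟩ := hφc.bounded_above_of_compact_support
      (hasCompactSupport_iterate_dirDeriv hc h (m + 1))
    rw [Function.iterate_succ_apply, ih hs' hc', iterate_dirDeriv_fwdDiff hψ, splineMeasure,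
      integral_map (by fun_prop) (by fun_prop), integral_prod]
    · refine integral_congr_ae (Eventually.of_forall fun t => ?_)
      simp only
      rw [fwdDiff_eq_integral (contDiff_iterate_dirDeriv hψ h m),
        ← Function.iterate_succ_apply' (dirDeriv h)]
      simp only [add_smul, add_assoc, hφ]
    · refine Integrable.of_bound (C := B) (by fun_prop) ?_
      exact Eventually.of_forall fun z => hB _

end Difference

lemma ae_splineMeasure_mem_Icc (m : ℕ) : ∀ᵐ t ∂(splineMeasure m), t ∈ Icc (0 : ℝ) m := by
  rcases Nat.eq_zero_or_pos m with rfl | hm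
  · rw [splineMeasure, ae_dirac_iff (by measurability)]
    simp
  · have h := lintegral_splineMeasure_le hm
      (u := (Icc (0 : ℝ) m)ᶜ.indicator 1) (measurable_one.indicator measurableSet_Icc.compl)
    rw [lintegral_indicator_one measurableSet_Icc.compl,
      lintegral_indicator_one measurableSet_Icc.compl,
      Measure.restrict_apply measurableSet_Icc.compl] at h
    rw [compl_inter_self, measure_empty, nonpos_iff_eq_zero] at h
    exact mem_ae_iff.2 h

section Pointwise

variable {n : ℕ}

lemma ae_enorm_le_of_enorm_integral_mul_le {u : En n → ℝ} (hu : LocallyIntegrable u volume)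
    {H : En n → ℝ≥0∞} (hH : Measurable H)
    (hfin : ∀ R : ℝ, ∫⁻ x in Metric.closedBall 0 R, H x < ∞)
    (h : ∀ ψ : En n → ℝ, ContDiff ℝ (⊤ : ℕ∞) ψ → HasCompactSupport ψ →
      ‖∫ x, u x * ψ x‖ₑ ≤ ∫⁻ x, ‖ψ x‖ₑ * H x) :
    ∀ᵐ x, ‖u x‖ₑ ≤ H x := by
  have hHtop : ∀ᵐ x, H x < ∞ := by
    have : ∀ N : ℕ, ∀ᵐ x, x ∈ Metric.closedBall (0 : En n) N → H x < ∞ := fun N =>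
      (ae_restrict_iff' Metric.isClosed_closedBall.measurableSet).1 (ae_lt_top hH (hfin N).ne)
    filter_upwards [ae_all_iff.2 this] with x hx
    obtain ⟨N, hN⟩ := exists_nat_ge ‖x‖
    exact hx N (by simpa using hN)
  have hloc : LocallyIntegrable (fun x => (H x).toReal) volume := by
    rw [locallyIntegrable_iff]
    intro K hK
    obtain ⟨R, hR⟩ := hK.isBounded.subset_closedBall 0
    exact (integrable_toReal_of_lintegral_ne_top hH.aemeasurable (hfin R).ne).mono_measure
      (Measure.restrict_mono hR le_rfl)
  set φ : ℕ → ContDiffBump (0 : En n) := fun i =>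
    ⟨1 / ((i : ℝ) + 1), 2 * (1 / ((i : ℝ) + 1)), by positivity, by
      have : 0 < 1 / ((i : ℝ) + 1) := by positivity
      linarith⟩ with hφ
  have hφ0 : Tendsto (fun i => (φ i).rOut) atTop (𝓝 0) := by
    simpa [hφ] using (tendsto_one_div_add_atTop_nhds_zero_nat (𝕜 := ℝ)).const_mul 2
  have hφK : ∀ᶠ i in atTop, (φ i).rOut ≤ 2 * (φ i).rIn := Eventually.of_forall fun i => le_rfl
  filter_upwards [ContDiffBump.ae_convolution_tendsto_right_of_locallyIntegrable hφ0 hφK hu,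
    ContDiffBump.ae_convolution_tendsto_right_of_locallyIntegrable hφ0 hφK hloc, hHtop]
    with x hx1 hx2 hx3
  have key : |u x| ≤ (H x).toReal := by
    refine le_of_tendsto_of_tendsto' hx1.abs hx2 fun i => ?_
    rw [convolution_lsmul_swap, convolution_lsmul_swap]
    set ψ : En n → ℝ := fun t => (φ i).normed volume (x - t) with hψ
    have hψc : ContDiff ℝ (⊤ : ℕ∞) ψ := (φ i).contDiff_normed.comp (by fun_prop)
    have hψs : HasCompactSupport ψ :=
      (φ i).hasCompactSupport_normed.comp_homeomorph (Homeomorph.subLeft x)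
    have hψ0 : ∀ t, 0 ≤ ψ t := fun t => (φ i).nonneg_normed _
    have hint : Integrable (fun t => ψ t • (H t).toReal) :=
      hloc.integrable_smul_left_of_hasCompactSupport hψc.continuous hψs
    have h1 := h ψ hψc hψs
    have h2 : ∫⁻ t, ‖ψ t‖ₑ * H t = ENNReal.ofReal (∫ t, ψ t • (H t).toReal) := by
      rw [ofReal_integral_eq_lintegral_ofReal hint
        (Eventually.of_forall fun t => mul_nonneg (hψ0 t) ENNReal.toReal_nonneg)]
      refine lintegral_congr_ae ?_
      filter_upwards [hHtop] with t ht
      simp only [smul_eq_mul]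
      rw [ENNReal.ofReal_mul (hψ0 t), ENNReal.ofReal_toReal ht.ne, Real.enorm_of_nonneg (hψ0 t)]
    have h3 : 0 ≤ ∫ t, ψ t • (H t).toReal :=
      integral_nonneg fun t => mul_nonneg (hψ0 t) ENNReal.toReal_nonneg
    rw [h2, Real.enorm_eq_ofReal_abs, ENNReal.ofReal_le_ofReal_iff h3] at h1
    have h4 : ∫ t, ψ t • u t = ∫ t, u t * ψ t :=
      integral_congr_ae (Eventually.of_forall fun t => mul_comm _ _)
    change |∫ t, ψ t • u t| ≤ ∫ t, ψ t • (H t).toReal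
    rwa [h4]
  rw [Real.enorm_eq_ofReal_abs]
  exact ENNReal.ofReal_le_of_le_toReal key

lemma locallyIntegrable_comp_add {f : En n → ℝ} (hf : LocallyIntegrable f volume) (z : En n) :
    LocallyIntegrable (fun x => f (x + z)) volume := by
  rw [locallyIntegrable_iff] at hf ⊢
  intro K hK
  have h := (measurePreserving_add_right (volume : Measure (En n)) z).integrableOn_image
    (MeasurableEquiv.addRight z).measurableEmbedding (f := f) (s := K)
  exact h.1 (hf _ (hK.image (continuous_add_const z)))

lemma locallyIntegrable_kDiff {f : En n → ℝ} (hf : LocallyIntegrable f volume) (m : ℕ) (h : En n) :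
    LocallyIntegrable (kDiff m f h) volume := by
  refine locallyIntegrable_finsetSum _ fun j _ => ?_
  exact (locallyIntegrable_comp_add hf ((j : ℝ) • h)).smul ((-1 : ℝ) ^ (m - j) * (m.choose j : ℝ))

lemma integral_kDiff_mul {f : En n → ℝ} (hf : LocallyIntegrable f volume) (m : ℕ) (h : En n)
    {ψ : En n → ℝ} (hψ : Continuous ψ) (hc : HasCompactSupport ψ) :
    ∫ x, kDiff m f h x * ψ x = ∫ y, f y * kDiff m ψ (-h) y := by
  unfold kDiff
  simp only [Finset.sum_mul, Finset.mul_sum]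
  have hcj : ∀ z : En n, HasCompactSupport fun x => ψ (x + z) := fun z =>
    hc.comp_homeomorph (Homeomorph.addRight z)
  rw [integral_finsetSum, integral_finsetSum]
  · refine Finset.sum_congr rfl fun j _ => ?_
    rw [← integral_sub_right_eq_self _ ((j : ℝ) • h)]
    refine integral_congr_ae (Eventually.of_forall fun x => ?_)
    simp only [sub_add_cancel, smul_neg, ← sub_eq_add_neg]
    ring
  · intro j _
    simp only [mul_left_comm (f _)]
    exact Integrable.const_mul (hf.integrable_smul_right_of_hasCompactSupport
      (hψ.comp (by fun_prop)) (hcj _)) _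
  · intro j _
    simp only [mul_assoc]
    exact (((locallyIntegrable_comp_add hf _).integrable_smul_right_of_hasCompactSupport
      hψ hc).const_mul _).const_mul _

lemma integrable_mul_comp_add_smul {f Φ : En n → ℝ} (hf : LocallyIntegrable f volume)
    (hfm : Measurable f) (hΦ : Continuous Φ) (hc : HasCompactSupport Φ) (h : En n) (m : ℕ) :
    Integrable (fun z : En n × ℝ => f z.1 * Φ (z.1 + z.2 • h))
      ((volume : Measure (En n)).prod (splineMeasure m)) := by
  obtain ⟨B, hB⟩ := hΦ.bounded_above_of_compact_support hc
  obtain ⟨R, hR⟩ := hc.isCompact.isBounded.subset_closedBall 0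
  set K := Metric.closedBall (0 : En n) (R + m * ‖h‖) with hK
  have h1 : Integrable (K.indicator f) :=
    (integrable_indicator_iff Metric.isClosed_closedBall.measurableSet).2
      ((locallyIntegrable_iff.1 hf) _ (isCompact_closedBall _ _))
  have h2 := h1.mul_prod (integrable_const (μ := splineMeasure m) B)
  refine h2.mono ?_ ?_
  · exact ((hfm.comp measurable_fst).mul (hΦ.measurable.comp (by fun_prop))).aestronglyMeasurable
  · have h3 : ∀ᵐ z : En n × ℝ ∂((volume : Measure (En n)).prod (splineMeasure m)),
        z.2 ∈ Icc (0 : ℝ) m :=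
      Measure.quasiMeasurePreserving_snd.ae (ae_splineMeasure_mem_Icc m)
    filter_upwards [h3] with z hz
    by_cases hz0 : Φ (z.1 + z.2 • h) = 0
    · simp only [hz0, mul_zero, norm_zero]
      positivity
    · have h4 : z.1 + z.2 • h ∈ Metric.closedBall (0 : En n) R :=
        hR (subset_tsupport _ hz0)
      have h5 : z.1 ∈ K := by
        rw [mem_closedBall_zero_iff] at h4 ⊢
        calc ‖z.1‖ = ‖(z.1 + z.2 • h) - z.2 • h‖ := by simp
          _ ≤ ‖z.1 + z.2 • h‖ + ‖z.2 • h‖ := norm_sub_le _ _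
          _ ≤ R + m * ‖h‖ := by
            rw [norm_smul, Real.norm_of_nonneg hz.1]
            have := hz.2
            gcongr
      rw [indicator_of_mem h5, norm_mul, norm_mul]
      gcongr
      exact (hB _).trans (le_abs_self B)

/-- The sum of the absolute values of all derivatives of order `m`, indexed by words. -/
noncomputable def derivSum (m : ℕ) (g : (Fin n → ℕ) → En n → ℝ) (x : En n) : ℝ≥0∞ :=
  ∑ w : Fin m → Fin n, ‖g (wordIndex w) x‖ₑ

lemma measurable_derivSum {m : ℕ} {g : (Fin n → ℕ) → En n → ℝ} (hg : ∀ α, Measurable (g α)) :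
    Measurable (derivSum m g) := by
  unfold derivSum
  fun_prop

lemma measurable_lintegral_splineMeasure {G : En n → ℝ≥0∞} (hG : Measurable G) (m : ℕ) :
    Measurable fun z : En n × En n => ∫⁻ t, G (z.1 + t • z.2) ∂(splineMeasure m) :=
  Measurable.lintegral_prod_right' (ν := splineMeasure m)
    (f := fun z : (En n × En n) × ℝ => G (z.1.1 + z.2 • z.1.2)) (hG.comp (by fun_prop))

lemma setLIntegral_lintegral_splineMeasure_lt_top {G : En n → ℝ≥0∞} (hG : Measurable G)
    (hfin : ∀ R : ℝ, ∫⁻ x in Metric.closedBall 0 R, G x < ∞) (m : ℕ) (h : En n) (R : ℝ) :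
    ∫⁻ x in Metric.closedBall 0 R, ∫⁻ t, G (x + t • h) ∂(splineMeasure m) < ∞ := by
  have m1 : Measurable fun z : En n × ℝ => G (z.1 + z.2 • h) := hG.comp (by fun_prop)
  rw [lintegral_lintegral_swap (f := fun x t => G (x + t • h)) m1.aemeasurable]
  refine lt_of_le_of_lt ?_ (hfin (R + m * ‖h‖))
  calc ∫⁻ t, (∫⁻ x in Metric.closedBall 0 R, G (x + t • h)) ∂(splineMeasure m)
      ≤ ∫⁻ _, (∫⁻ x in Metric.closedBall 0 (R + m * ‖h‖), G x) ∂(splineMeasure m) := by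
        refine lintegral_mono_ae ?_
        filter_upwards [ae_splineMeasure_mem_Icc m] with t ht
        rw [← lintegral_indicator Metric.isClosed_closedBall.measurableSet,
          ← lintegral_indicator Metric.isClosed_closedBall.measurableSet]
        conv_rhs => rw [← lintegral_add_right_eq_self _ (t • h)]
        refine lintegral_mono fun x => ?_
        simp only [indicator_apply, mem_closedBall_zero_iff]
        split_ifs with h1 h2
        · exact le_rfl
        · refine absurd ?_ h2
          refine (norm_add_le _ _).trans ?_
          rw [norm_smul, Real.norm_of_nonneg ht.1]
          have := ht.2
          gcongr
        · exact zero_le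
        · exact le_rfl
    _ = _ := by simp

lemma HasWeakDerivs.setLIntegral_derivSum_lt_top {m : ℕ} {f : En n → ℝ}
    {g : (Fin n → ℕ) → En n → ℝ} (hg : HasWeakDerivs m f g) (hgm : ∀ α, Measurable (g α)) (R : ℝ) :
    ∫⁻ x in Metric.closedBall 0 R, derivSum m g x < ∞ := by
  unfold derivSum
  rw [lintegral_finsetSum _ fun w _ => (hgm _).enorm, ENNReal.sum_lt_top]
  intro w _
  exact ((locallyIntegrable_iff.1 (hg.1 _ (sum_wordIndex w))) _ (isCompact_closedBall _ _)).2

lemma HasWeakDerivs.enorm_integral_kDiff_mul_le {m : ℕ} {f : En n → ℝ}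
    {g : (Fin n → ℕ) → En n → ℝ} (hf : LocallyIntegrable f volume) (hfm : Measurable f)
    (hg : HasWeakDerivs m f g) (hgm : ∀ α, Measurable (g α)) (h : En n)
    {ψ : En n → ℝ} (hψ : ContDiff ℝ (⊤ : ℕ∞) ψ) (hc : HasCompactSupport ψ) :
    ‖∫ x, kDiff m f h x * ψ x‖ₑ ≤ ∫⁻ x, ‖ψ x‖ₑ *
      (ENNReal.ofReal (‖h‖ ^ m) * ∫⁻ t, derivSum m g (x + t • h) ∂(splineMeasure m)) := by
  have mG := measurable_derivSum (m := m) hgm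
  rw [integral_kDiff_mul hf m h hψ.continuous hc]
  simp only [kDiff_eq_integral_splineMeasure hψ hc, ← integral_const_mul]
  rw [integral_integral_swap (integrable_mul_comp_add_smul hf hfm
    (contDiff_iterate_dirDeriv hψ (-h) m).continuous
    (hasCompactSupport_iterate_dirDeriv hc (-h) m) (-h) m)]
  have hψz : ∀ z, ContDiff ℝ (⊤ : ℕ∞) fun x => ψ (x + z) := fun z => hψ.comp (by fun_prop)
  have hcz : ∀ z : En n, HasCompactSupport fun x => ψ (x + z) := fun z =>
    hc.comp_homeomorph (Homeomorph.addRight z)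
  have hid : ∀ t : ℝ, ∫ y, f y * (dirDeriv (-h))^[m] ψ (y + t • -h) =
      (-1) ^ m * ∑ w : Fin m → Fin n, (∏ j, (-h) (w j)) *
        ∫ x, g (wordIndex w) x * ψ (x + t • -h) := by
    intro t
    have := hg.integral_mul_iterate_dirDeriv hf (hψz (t • -h)) (hcz (t • -h)) (-h)
    rwa [iterate_dirDeriv_comp_add] at this
  simp only [hid]
  have hbound : ∀ t : ℝ, ‖(-1) ^ m * ∑ w : Fin m → Fin n, (∏ j, (-h) (w j)) *
        ∫ x, g (wordIndex w) x * ψ (x + t • -h)‖ₑ ≤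
      ENNReal.ofReal (‖h‖ ^ m) * ∫⁻ x, ‖ψ x‖ₑ * derivSum m g (x + t • h) := by
    intro t
    have h1 : ∀ w : Fin m → Fin n, ‖∏ j, (-h) (w j)‖ₑ ≤ ENNReal.ofReal (‖h‖ ^ m) := by
      intro w
      rw [← ofReal_norm, norm_prod]
      refine ENNReal.ofReal_le_ofReal ?_
      calc ∏ j, ‖(-h) (w j)‖ ≤ ∏ _j : Fin m, ‖h‖ :=
            Finset.prod_le_prod (fun _ _ => norm_nonneg _) fun j _ => by
              simpa using PiLp.norm_apply_le h (w j)
        _ = ‖h‖ ^ m := by simp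
    have h2 : ∀ w : Fin m → Fin n, ‖∫ x, g (wordIndex w) x * ψ (x + t • -h)‖ₑ ≤
        ∫⁻ x, ‖ψ x‖ₑ * ‖g (wordIndex w) (x + t • h)‖ₑ := by
      intro w
      refine (enorm_integral_le_lintegral_enorm _).trans (le_of_eq ?_)
      rw [← lintegral_add_right_eq_self _ (t • h)]
      refine lintegral_congr fun x => ?_
      simp [enorm_mul, mul_comm]
    have h3 : ∀ w : Fin m → Fin n,
        Measurable fun x => ‖ψ x‖ₑ * ‖g (wordIndex w) (x + t • h)‖ₑ := fun w =>
      hψ.continuous.measurable.enorm.mul ((hgm _).comp (by fun_prop)).enorm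
    calc _ ≤ ∑ w : Fin m → Fin n, ‖(∏ j, (-h) (w j)) *
            ∫ x, g (wordIndex w) x * ψ (x + t • -h)‖ₑ := by
          rw [enorm_mul]
          refine (mul_le_mul' le_rfl (enorm_sum_le Finset.univ _)).trans (le_of_eq ?_)
          simp
      _ ≤ ∑ w : Fin m → Fin n, ENNReal.ofReal (‖h‖ ^ m) *
            ∫⁻ x, ‖ψ x‖ₑ * ‖g (wordIndex w) (x + t • h)‖ₑ := by
          refine Finset.sum_le_sum fun w _ => ?_
          rw [enorm_mul]
          exact mul_le_mul' (h1 w) (h2 w)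
      _ = _ := by
          rw [← Finset.mul_sum, ← lintegral_finsetSum _ fun w _ => h3 w]
          simp only [derivSum, Finset.mul_sum]
  refine (enorm_integral_le_lintegral_enorm _).trans ((lintegral_mono hbound).trans (le_of_eq ?_))
  have m1 : Measurable fun z : ℝ × En n => ‖ψ z.2‖ₑ * derivSum m g (z.2 + z.1 • h) :=
    (hψ.continuous.measurable.comp measurable_snd).enorm.mul (mG.comp (by fun_prop))
  have m2 : Measurable fun t : ℝ => ∫⁻ x, ‖ψ x‖ₑ * derivSum m g (x + t • h) :=
    Measurable.lintegral_prod_right' m1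
  have m3 : Measurable fun x => ∫⁻ t, ‖ψ x‖ₑ * derivSum m g (x + t • h) ∂(splineMeasure m) :=
    Measurable.lintegral_prod_left' (μ := splineMeasure m) m1
  rw [lintegral_const_mul _ m2, lintegral_lintegral_swap
    (f := fun t x => ‖ψ x‖ₑ * derivSum m g (x + t • h)) m1.aemeasurable,
    ← lintegral_const_mul _ m3]
  refine lintegral_congr fun x => ?_
  have m4 : Measurable fun t : ℝ => derivSum m g (x + t • h) := mG.comp (by fun_prop)
  rw [lintegral_const_mul _ m4, mul_left_comm]

theorem HasWeakDerivs.ae_enorm_kDiff_le {m : ℕ} {f : En n → ℝ}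
    {g : (Fin n → ℕ) → En n → ℝ} (hf : LocallyIntegrable f volume) (hfm : Measurable f)
    (hg : HasWeakDerivs m f g) (hgm : ∀ α, Measurable (g α)) (h : En n) :
    ∀ᵐ x, ‖kDiff m f h x‖ₑ ≤
      ENNReal.ofReal (‖h‖ ^ m) * ∫⁻ t, derivSum m g (x + t • h) ∂(splineMeasure m) := by
  have mG := measurable_derivSum (m := m) hgm
  have mH : Measurable fun x => ∫⁻ t, derivSum m g (x + t • h) ∂(splineMeasure m) :=
    Measurable.lintegral_prod_right' (ν := splineMeasure m)
      (f := fun z : En n × ℝ => derivSum m g (z.1 + z.2 • h)) (mG.comp (by fun_prop))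
  refine ae_enorm_le_of_enorm_integral_mul_le (locallyIntegrable_kDiff hf m h)
    (mH.const_mul (ENNReal.ofReal (‖h‖ ^ m))) (fun R => ?_) ?_
  · rw [lintegral_const_mul _ mH]
    exact ENNReal.mul_lt_top ENNReal.ofReal_lt_top
      (setLIntegral_lintegral_splineMeasure_lt_top mG (hg.setLIntegral_derivSum_lt_top hgm) m h R)
  · intro ψ hψ hc
    exact hg.enorm_integral_kDiff_mul_le hf hfm hgm h hψ hc

end Pointwise

section Gradient

variable {n : ℕ}

lemma abs_le_gradLen {m : ℕ} (g : (Fin n → ℕ) → En n → ℝ) (x : En n) {α : Fin n → ℕ}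
    (hα : ∑ i, α i = m) : |g α x| ≤ gradLen m g x := by
  have hfin : {β : Fin n → ℕ | ∑ i, β i = m}.Finite := by
    refine (Set.finite_Iic (fun _ => m : Fin n → ℕ)).subset fun β hβ i => ?_
    have hβ' : ∑ i, β i = m := hβ
    exact hβ' ▸ Finset.single_le_sum (fun _ _ => Nat.zero_le _) (Finset.mem_univ i)
  have hsum : Summable fun β : Fin n → ℕ => if (∑ i, β i) = m then (g β x) ^ 2 else 0 := by
    refine summable_of_hasFiniteSupport (hfin.subset fun β hβ => ?_)
    by_contra h
    exact hβ (if_neg h)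
  refine Real.abs_le_sqrt ?_
  have h := hsum.le_tsum α fun β _ => by split_ifs <;> positivity
  rwa [if_pos hα] at h

lemma derivSum_le_gradLen (m : ℕ) (g : (Fin n → ℕ) → En n → ℝ) (x : En n) :
    derivSum m g x ≤ (n ^ m : ℕ) * ENNReal.ofReal (gradLen m g x) := by
  calc derivSum m g x ≤ ∑ _w : Fin m → Fin n, ENNReal.ofReal (gradLen m g x) := by
        refine Finset.sum_le_sum fun w _ => ?_
        rw [Real.enorm_eq_ofReal_abs]
        exact ENNReal.ofReal_le_ofReal (abs_le_gradLen g x (sum_wordIndex w))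
    _ = _ := by simp

lemma lintegral_derivSum_rpow_le {p : ℝ} (hp : 0 < p) (m : ℕ) (g : (Fin n → ℕ) → En n → ℝ) :
    ∫⁻ x, derivSum m g x ^ p ≤ ((n ^ m : ℕ) : ℝ≥0∞) ^ p * gradLp p m g ^ p := by
  calc ∫⁻ x, derivSum m g x ^ p
      ≤ ∫⁻ x, ((n ^ m : ℕ) : ℝ≥0∞) ^ p * ENNReal.ofReal (gradLen m g x ^ p) := by
        refine lintegral_mono fun x => ?_
        rw [← ENNReal.ofReal_rpow_of_nonneg (show 0 ≤ gradLen m g x from Real.sqrt_nonneg _) hp.le,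
          ← ENNReal.mul_rpow_of_nonneg _ _ hp.le]
        exact ENNReal.rpow_le_rpow (derivSum_le_gradLen m g x) hp.le
    _ = _ := by
        rw [lintegral_const_mul' _ _ (ENNReal.rpow_ne_top_of_nonneg hp.le (by simp)), gradLp,
          ← ENNReal.rpow_mul, one_div_mul_cancel hp.ne', ENNReal.rpow_one]

lemma HasWeakDerivs.exists_measurable {m : ℕ} {f f' : En n → ℝ} {g : (Fin n → ℕ) → En n → ℝ}
    (hg : HasWeakDerivs m f g) (hff' : f =ᵐ[volume] f') :
    ∃ g' : (Fin n → ℕ) → En n → ℝ, (∀ α, Measurable (g' α)) ∧ HasWeakDerivs m f' g' ∧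
      derivSum m g' =ᵐ[volume] derivSum m g := by
  have hm : ∀ α : Fin n → ℕ, ∃ u : En n → ℝ, Measurable u ∧
      ((∑ i, α i) = m → g α =ᵐ[volume] u) := by
    intro α
    by_cases hα : (∑ i, α i) = m
    · have h := (hg.1 α hα).aestronglyMeasurable
      exact ⟨h.mk, h.stronglyMeasurable_mk.measurable, fun _ => h.ae_eq_mk⟩
    · exact ⟨0, measurable_zero, fun h => absurd h hα⟩
  choose g' hg'm hg' using hm
  refine ⟨g', hg'm, ⟨fun α hα => (hg.1 α hα).congr (hg' α hα), fun α hα φ hφ hc => ?_⟩, ?_⟩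
  · have h1 : ∫ x, f' x * mpd α φ x = ∫ x, f x * mpd α φ x := by
      refine integral_congr_ae ?_
      filter_upwards [hff'] with x hx
      rw [hx]
    have h2 : ∫ x, g' α x * φ x = ∫ x, g α x * φ x := by
      refine integral_congr_ae ?_
      filter_upwards [hg' α hα] with x hx
      rw [hx]
    rw [h1, h2, hg.2 α hα φ hφ hc]
  · have : ∀ᵐ x, ∀ w : Fin m → Fin n, g (wordIndex w) x = g' (wordIndex w) x :=
      ae_all_iff.2 fun w => hg' _ (sum_wordIndex w)
    filter_upwards [this] with x hx
    simp only [derivSum, hx]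

lemma innerInt_ae_eq {f f' : En n → ℝ} (hff' : f =ᵐ[volume] f') (k l : ℕ) (lam b γ : ℝ) :
    innerInt k l lam b γ f =ᵐ[volume] innerInt k l lam b γ f' := by
  set N := toMeasurable volume {x | f x ≠ f' x} with hN
  have hN0 : volume N = 0 := by rw [hN, measure_toMeasurable]; exact hff'
  have hNm : MeasurableSet N := measurableSet_toMeasurable _ _
  have hsub : ∀ x, x ∉ N → f x = f' x := fun x hx => by
    by_contra h
    exact hx (subset_toMeasurable _ _ h)
  have key : ∀ j : ℕ, ∀ᵐ x : En n, ∀ᵐ h : En n, x + (j : ℝ) • h ∉ N := by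
    intro j
    have hm : Measurable fun z : En n × En n => z.1 + (j : ℝ) • z.2 := by fun_prop
    refine (Measure.ae_ae_comm (p := fun x h : En n => x + (j : ℝ) • h ∉ N) (hm hNm.compl)).2 ?_
    refine Eventually.of_forall fun h => ?_
    have h1 : ∀ᵐ x : En n, x ∉ N := measure_eq_zero_iff_ae_notMem.1 hN0
    exact (measurePreserving_add_right (volume : Measure (En n))
      ((j : ℝ) • h)).quasiMeasurePreserving.ae h1
  filter_upwards [ae_all_iff.2 key] with x hx
  refine lintegral_congr_ae ?_
  filter_upwards [ae_all_iff.2 hx] with h hh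
  have : kDiff k f h x = kDiff k f' h x := by
    simp only [kDiff]
    refine Finset.sum_congr rfl fun j _ => ?_
    rw [hsub _ (hh j)]
  exact if_congr (by simp only [memE, this]) rfl rfl

lemma lintegral_cutPow_spline_le (hn : 0 < n) {γ p : ℝ} (hp : 1 ≤ p) (hγ : γ ∈ Gam p 1) (m : ℕ)
    {a : ℝ} (ha : a = 0 ∨ a = 1) : ∃ C : ℝ≥0, ∀ G : En n → ℝ≥0∞, Measurable G →
      ∫⁻ x, (∫⁻ h, cutPow γ (γ - n + 1) (∫⁻ t, G (x + (a + t) • h) ∂(splineMeasure m)) ‖h‖) ^ p ≤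
        C * ∫⁻ x, G x ^ p := by
  have hγ0 : γ ≠ 0 := by
    rintro rfl
    unfold Gam at hγ
    split_ifs at hγ <;> simp at hγ
    linarith
  rcases Nat.eq_zero_or_pos m with rfl | hm
  · have hdirac : ∀ (G : En n → ℝ≥0∞), Measurable G → ∀ x h : En n,
        ∫⁻ t, G (x + (a + t) • h) ∂(splineMeasure 0) = G (x + a • h) := by
      intro G hG x h
      have m1 : Measurable fun t : ℝ => G (x + (a + t) • h) := hG.comp (by fun_prop)
      rw [splineMeasure, lintegral_dirac' _ m1, add_zero]
    rcases ha with rfl | rfl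
    · obtain ⟨C, hC⟩ := lintegral_cutPow_self_le hn hp hγ0
      refine ⟨C, fun G hG => ?_⟩
      simpa only [hdirac G hG, zero_smul, add_zero] using hC G hG
    · obtain ⟨C, hC⟩ := lintegral_cutPow_translate_le hn hp hγ0
      refine ⟨C, fun G hG => ?_⟩
      simpa only [hdirac G hG, one_smul] using hC G hG
  · obtain ⟨C, hC⟩ := lintegral_cutPow_segment_le (κ := m + 1) hn (by positivity) hp hγ
    refine ⟨C, fun G hG => le_trans (lintegral_mono fun x => ?_) (hC G hG)⟩
    refine ENNReal.rpow_le_rpow (lintegral_mono fun h => cutPow_mono _ _ ?_ _) (by linarith)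
    have m1 : Measurable fun t : ℝ => G (x + (a + t) • h) := hG.comp (by fun_prop)
    refine (lintegral_splineMeasure_le hm m1).trans ?_
    rw [← lintegral_indicator measurableSet_Icc, ← lintegral_indicator measurableSet_Icc]
    conv_rhs => rw [← lintegral_add_left_eq_self _ a]
    refine lintegral_mono fun t => ?_
    simp only [indicator_apply, mem_Icc]
    split_ifs with h1 h2
    · exact le_rfl
    · refine absurd ?_ h2
      rcases ha with rfl | rfl <;> constructor <;> linarith [h1.1, h1.2]
    · exact zero_le
    · exact le_rfl

end Gradient

section Core

variable {n : ℕ}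

lemma measurable_kDiff {f : En n → ℝ} (hf : Measurable f) (k : ℕ) :
    Measurable fun z : En n × En n => kDiff k f z.2 z.1 := by
  unfold kDiff
  refine Finset.measurable_sum _ fun j _ => ?_
  have m1 : Measurable fun z : En n × En n => f (z.1 + (j : ℝ) • z.2) := hf.comp (by fun_prop)
  exact m1.const_mul _

lemma measurable_lintegral_splineMeasure_add {G : En n → ℝ≥0∞} (hG : Measurable G) (m : ℕ)
    (a : ℝ) : Measurable fun z : En n × En n =>
      ∫⁻ t, G (z.1 + (a + t) • z.2) ∂(splineMeasure m) :=
  Measurable.lintegral_prod_right' (ν := splineMeasure m)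
    (f := fun z : (En n × En n) × ℝ => G (z.1.1 + (a + z.2) • z.1.2)) (hG.comp (by fun_prop))

lemma ae_ae_add_smul_of_ae {F H : En n → En n → ℝ≥0∞}
    (hF : Measurable fun z : En n × En n => F z.1 z.2)
    (hH : Measurable fun z : En n × En n => H z.1 z.2) (hle : ∀ h, ∀ᵐ x, F x h ≤ H x h) (a : ℝ) :
    ∀ᵐ x : En n, ∀ᵐ h : En n, F (x + a • h) h ≤ H (x + a • h) h := by
  have hz : Measurable fun z : En n × En n => (z.1 + a • z.2, z.2) := by fun_prop
  refine (Measure.ae_ae_comm (p := fun x h : En n => F (x + a • h) h ≤ H (x + a • h) h)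
    (measurableSet_le (hF.comp hz) (hH.comp hz))).2 (Eventually.of_forall fun h => ?_)
  exact (measurePreserving_add_right (volume : Measure (En n))
    (a • h)).quasiMeasurePreserving.ae (hle h)

lemma HasWeakDerivs.ae_ae_enorm_kDiff_le {m : ℕ} {f : En n → ℝ} {g : (Fin n → ℕ) → En n → ℝ}
    (hf : LocallyIntegrable f volume) (hfm : Measurable f) (hg : HasWeakDerivs m f g)
    (hgm : ∀ α, Measurable (g α)) (a : ℝ) :
    ∀ᵐ x : En n, ∀ᵐ h : En n, ‖kDiff m f h (x + a • h)‖ₑ ≤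
      ENNReal.ofReal (‖h‖ ^ m) * ∫⁻ t, derivSum m g (x + (a + t) • h) ∂(splineMeasure m) := by
  have m1 : Measurable fun z : En n × En n => ‖kDiff m f z.2 z.1‖ₑ :=
    (measurable_kDiff hfm m).enorm
  have m2 : Measurable fun z : En n × En n => ENNReal.ofReal (‖z.2‖ ^ m) := by fun_prop
  have m3 := m2.mul (measurable_lintegral_splineMeasure (measurable_derivSum (m := m) hgm) m)
  have key := ae_ae_add_smul_of_ae (F := fun x h => ‖kDiff m f h x‖ₑ)
    (H := fun x h => ENNReal.ofReal (‖h‖ ^ m) *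
      ∫⁻ t, derivSum m g (x + t • h) ∂(splineMeasure m)) m1 m3
    (hg.ae_enorm_kDiff_le hf hfm hgm) a
  simpa only [add_smul, add_assoc] using key

lemma memE_interpolation {k : ℕ} {A B s γ q₀ q : ℝ} (hA : 0 < A) (hB : 0 < B)
    (hs : s ∈ Ioo (0 : ℝ) 1) (hqs : 1 / q = (1 - s) / q₀ + s) {f : En n → ℝ} {x h : En n}
    (hE : memE k k (A ^ (1 - s) * B ^ s) (γ / q + s - 1) f x h) :
    A * ‖h‖ ^ ((k : ℝ) - 1 + γ / q₀) < |kDiff k f h x| ∨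
      B * ‖h‖ ^ ((k : ℝ) + γ) < |kDiff k f h x| := by
  obtain ⟨h0, hE⟩ := hE
  by_contra! hcon
  obtain ⟨h1, h2⟩ := hcon
  have hr : 0 < ‖h‖ := norm_pos_iff.2 h0
  refine hE.not_ge ?_
  set D := |kDiff k f h x| with hD
  have hD0 : 0 ≤ D := abs_nonneg _
  calc D = D ^ (1 - s) * D ^ s := by
        rw [← Real.rpow_add_of_nonneg hD0 (by linarith [hs.2]) hs.1.le]; simp
    _ ≤ (A * ‖h‖ ^ ((k : ℝ) - 1 + γ / q₀)) ^ (1 - s) * (B * ‖h‖ ^ ((k : ℝ) + γ)) ^ s := by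
        gcongr
        · linarith [hs.2]
        · exact hs.1.le
    _ = A ^ (1 - s) * B ^ s * ‖h‖ ^ ((k : ℝ) + (γ / q + s - 1)) := by
        have e : (k : ℝ) + (γ / q + s - 1) =
            ((k : ℝ) - 1 + γ / q₀) * (1 - s) + ((k : ℝ) + γ) * s := by
          have : γ / q = γ * (1 / q) := by ring
          rw [this, hqs]; ring
        rw [e, Real.rpow_add hr (_ * _), Real.rpow_mul hr.le, Real.rpow_mul hr.le,
          Real.mul_rpow hA.le (by positivity), Real.mul_rpow hB.le (by positivity)]
        ring

lemma ofReal_rpow_lt_of_lt_mul {A r c : ℝ} (hA : 0 < A) (hr : 0 < r) (m : ℕ) {Y : ℝ≥0∞}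
    (h : ENNReal.ofReal (A * r ^ ((m : ℝ) + c)) < ENNReal.ofReal (r ^ m) * Y) :
    ENNReal.ofReal (r ^ c) < ENNReal.ofReal A⁻¹ * Y := by
  by_contra! hcon
  refine h.not_ge ?_
  have e1 : ENNReal.ofReal (A * r ^ ((m : ℝ) + c)) =
      ENNReal.ofReal (r ^ m) * (ENNReal.ofReal A * ENNReal.ofReal (r ^ c)) := by
    rw [← ENNReal.ofReal_mul hA.le, ← ENNReal.ofReal_mul (by positivity), Real.rpow_add hr,
      Real.rpow_natCast]
    ring_nf
  have e2 : Y = ENNReal.ofReal A * (ENNReal.ofReal A⁻¹ * Y) := by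
    rw [← mul_assoc, ← ENNReal.ofReal_mul hA.le, mul_inv_cancel₀ hA.ne', ENNReal.ofReal_one,
      one_mul]
  rw [e1, e2]
  gcongr

lemma memE_threshold {m : ℕ} {A B s γ q₀ q : ℝ} (hA : 0 < A) (hB : 0 < B)
    (hs : s ∈ Ioo (0 : ℝ) 1) (hq₀ : 1 ≤ q₀) (hqs : 1 / q = (1 - s) / q₀ + s) {f : En n → ℝ}
    {x h : En n} (hE : memE (m + 1) (m + 1) (A ^ (1 - s) * B ^ s) (γ / q + s - 1) f x h)
    {Y₀ Y₁ Y₂ : ℝ≥0∞} (h₀ : ‖kDiff m f h x‖ₑ ≤ ENNReal.ofReal (‖h‖ ^ m) * Y₀)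
    (h₁ : ‖kDiff m f h (x + h)‖ₑ ≤ ENNReal.ofReal (‖h‖ ^ m) * Y₁)
    (h₂ : ‖kDiff (m + 1) f h x‖ₑ ≤ ENNReal.ofReal (‖h‖ ^ (m + 1)) * Y₂) :
    ENNReal.ofReal (‖h‖ ^ γ) < (ENNReal.ofReal (A / 2)⁻¹ * Y₀) ^ q₀ ∨
      ENNReal.ofReal (‖h‖ ^ γ) < (ENNReal.ofReal (A / 2)⁻¹ * Y₁) ^ q₀ ∨
      ENNReal.ofReal (‖h‖ ^ γ) < ENNReal.ofReal B⁻¹ * Y₂ := by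
  have hr : 0 < ‖h‖ := norm_pos_iff.2 hE.1
  have hlt : ∀ {u : ℝ}, 0 ≤ u → u < |kDiff (m + 1) f h x| →
      ENNReal.ofReal u < ‖kDiff (m + 1) f h x‖ₑ := fun hu huv => by
    rw [Real.enorm_eq_ofReal_abs]
    exact (ENNReal.ofReal_lt_ofReal_iff_of_nonneg hu).2 huv
  have hq0 : 0 < q₀ := by linarith
  have hroot : ∀ {Y : ℝ≥0∞}, ENNReal.ofReal (A / 2 * ‖h‖ ^ ((m : ℝ) + γ / q₀)) <
      ENNReal.ofReal (‖h‖ ^ m) * Y →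
      ENNReal.ofReal (‖h‖ ^ γ) < (ENNReal.ofReal (A / 2)⁻¹ * Y) ^ q₀ := fun hY => by
    have h3 := ENNReal.rpow_lt_rpow (ofReal_rpow_lt_of_lt_mul (by positivity) hr m hY) hq0
    rwa [ENNReal.ofReal_rpow_of_nonneg (by positivity) hq0.le, ← Real.rpow_mul hr.le,
      div_mul_cancel₀ _ hq0.ne'] at h3
  rcases memE_interpolation hA hB hs hqs hE with h3 | h3
  · rw [Nat.cast_add_one, add_sub_cancel_right] at h3
    have h4 := hlt (by positivity) h3
    by_contra! hcon
    have h5 : ENNReal.ofReal (‖h‖ ^ m) * Y₀ ≤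
        ENNReal.ofReal (A / 2 * ‖h‖ ^ ((m : ℝ) + γ / q₀)) := by
      by_contra! h6
      exact hcon.1.not_gt (hroot h6)
    have h6 : ENNReal.ofReal (‖h‖ ^ m) * Y₁ ≤
        ENNReal.ofReal (A / 2 * ‖h‖ ^ ((m : ℝ) + γ / q₀)) := by
      by_contra! h6
      exact hcon.2.1.not_gt (hroot h6)
    refine h4.not_ge ?_
    calc ‖kDiff (m + 1) f h x‖ₑ ≤ ‖kDiff m f h (x + h)‖ₑ + ‖kDiff m f h x‖ₑ := by
          rw [kDiff_succ]; exact enorm_sub_le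
      _ ≤ _ := add_le_add (h₁.trans h6) (h₀.trans h5)
      _ = _ := by
          rw [← ENNReal.ofReal_add (by positivity) (by positivity)]
          ring_nf
  · refine Or.inr (Or.inr (ofReal_rpow_lt_of_lt_mul hB hr (m + 1) ?_))
    exact (hlt (by positivity) h3).trans_le h₂

end Core

section Estimate

variable {n : ℕ}

lemma rpow_add_add_le_mul {p : ℝ} (hp : 0 ≤ p) (a b c : ℝ≥0∞) :
    (a + b + c) ^ p ≤ 3 ^ p * (a ^ p + b ^ p + c ^ p) := by
  have h1 : a + b + c ≤ 3 * max (max a b) c := by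
    calc a + b + c ≤ max (max a b) c + max (max a b) c + max (max a b) c := by
          gcongr <;> simp
      _ = _ := by ring
  refine (ENNReal.rpow_le_rpow h1 hp).trans ?_
  rw [ENNReal.mul_rpow_of_nonneg _ _ hp]
  gcongr
  rcases max_choice (max a b) c with h | h <;> rw [h]
  · rcases max_choice a b with h' | h' <;> rw [h']
    · rw [add_assoc]; exact le_self_add
    · rw [add_right_comm]; exact le_add_self
  · exact le_add_self

lemma rpow_lintegral_splineMeasure_le {q₀ : ℝ} (hq₀ : 1 ≤ q₀) (m : ℕ) (c : ℝ≥0∞)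
    {G : En n → ℝ≥0∞} (hG : Measurable G) (a : ℝ) (x h : En n) :
    (c * ∫⁻ t, G (x + (a + t) • h) ∂(splineMeasure m)) ^ q₀ ≤
      ∫⁻ t, (c * G (x + (a + t) • h)) ^ q₀ ∂(splineMeasure m) := by
  have m1 : Measurable fun t : ℝ => G (x + (a + t) • h) := hG.comp (by fun_prop)
  rw [← lintegral_const_mul _ m1]
  simpa using lintegral_rpow_le_measure_univ_mul (splineMeasure m) hq₀ (m1.const_mul c)

lemma innerInt_le_of_threshold {k l : ℕ} {lam b γ : ℝ} {f : En n → ℝ} {x : En n}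
    {W₀ W₁ W₂ : En n → ℝ≥0∞} (hW₀ : Measurable W₀) (hW₁ : Measurable W₁)
    (hE : ∀ᵐ h, memE k l lam b f x h → ENNReal.ofReal (‖h‖ ^ γ) < W₀ h ∨
      ENNReal.ofReal (‖h‖ ^ γ) < W₁ h ∨ ENNReal.ofReal (‖h‖ ^ γ) < W₂ h) :
    innerInt k l lam b γ f x ≤ (∫⁻ h, cutPow γ (γ - n + 1) (W₀ h) ‖h‖) +
      (∫⁻ h, cutPow γ (γ - n + 1) (W₁ h) ‖h‖) + ∫⁻ h, cutPow γ (γ - n + 1) (W₂ h) ‖h‖ := by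
  have m0 := measurable_cutPow γ (γ - n + 1) hW₀ measurable_norm
  have m1 := measurable_cutPow γ (γ - n + 1) hW₁ measurable_norm
  have m01 : Measurable fun h => cutPow γ (γ - n + 1) (W₀ h) ‖h‖ +
      cutPow γ (γ - n + 1) (W₁ h) ‖h‖ := m0.add m1
  rw [← lintegral_add_left m0, ← lintegral_add_left m01]
  refine lintegral_mono_ae ?_
  filter_upwards [hE] with h hh
  split_ifs with hmem
  · have e : ∀ W : ℝ≥0∞, ENNReal.ofReal (‖h‖ ^ γ) < W →
        cutPow γ (γ - n + 1) W ‖h‖ = ENNReal.ofReal (‖h‖ ^ (γ - (n : ℝ))) := fun W hW => by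
      rw [cutPow, if_pos hW, add_sub_cancel_right]
    rcases hh hmem with h1 | h1 | h1
    · rw [← e _ h1, add_assoc]; exact le_self_add
    · rw [← e _ h1, add_right_comm]; exact le_add_self
    · rw [← e _ h1]; exact le_add_self
  · exact zero_le

lemma measurable_lintegral_cutPow_spline {G : En n → ℝ≥0∞} (hG : Measurable G) (m : ℕ)
    (a β γ : ℝ) : Measurable fun x : En n =>
      ∫⁻ h, cutPow β γ (∫⁻ t, G (x + (a + t) • h) ∂(splineMeasure m)) ‖h‖ := by
  have m1 : Measurable fun z : En n × En n =>
      cutPow β γ (∫⁻ t, G (z.1 + (a + t) • z.2) ∂(splineMeasure m)) ‖z.2‖ :=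
    measurable_cutPow β γ (measurable_lintegral_splineMeasure_add hG m a) (by fun_prop)
  exact m1.lintegral_prod_right'

lemma lintegral_innerInt_rpow_le (hn : 0 < n) {p γ : ℝ} (hp : 1 ≤ p) (hγ : γ ∈ Gam p 1) (m : ℕ)
    {s q₀ q : ℝ} (hs : s ∈ Ioo (0 : ℝ) 1) (hq₀ : 1 ≤ q₀) (hqs : 1 / q = (1 - s) / q₀ + s) :
    ∃ K : ℝ≥0, ∀ (f : En n → ℝ) (g₁ g₂ : (Fin n → ℕ) → En n → ℝ), LocallyIntegrable f volume →
      HasWeakDerivs m f g₁ → HasWeakDerivs (m + 1) f g₂ → ∀ A B : ℝ, 0 < A → 0 < B →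
      ∫⁻ x, (innerInt (m + 1) (m + 1) (A ^ (1 - s) * B ^ s) (γ / q + s - 1) γ f x) ^ p ≤
        K * ((ENNReal.ofReal A⁻¹ * gradLp (p * q₀) m g₁) ^ (p * q₀) +
          (ENNReal.ofReal B⁻¹ * gradLp p (m + 1) g₂) ^ p) := by
  have hp0 : 0 < p := by linarith
  have hq0 : 0 < q₀ := by linarith
  have hpq : 0 < p * q₀ := by positivity
  obtain ⟨C₀, hC₀⟩ := lintegral_cutPow_spline_le hn hp hγ m (Or.inl (rfl : (0 : ℝ) = 0))
  obtain ⟨C₁, hC₁⟩ := lintegral_cutPow_spline_le hn hp hγ m (Or.inr (rfl : (1 : ℝ) = 1))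
  obtain ⟨C₂, hC₂⟩ := lintegral_cutPow_spline_le hn hp hγ (m + 1) (Or.inl (rfl : (0 : ℝ) = 0))
  refine ⟨3 ^ p * ((C₀ + C₁) * (2 ^ (p * q₀) * ((n ^ m : ℕ) : ℝ≥0) ^ (p * q₀)) +
    C₂ * ((n ^ (m + 1) : ℕ) : ℝ≥0) ^ p), ?_⟩
  intro f₀ g₁₀ g₂₀ hf₀ hg₁₀ hg₂₀ A B hA hB
  have hmk := hf₀.aestronglyMeasurable
  set f := hmk.mk with hfdef
  have hff : f₀ =ᵐ[volume] f := hmk.ae_eq_mk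
  have hfm : Measurable f := hmk.stronglyMeasurable_mk.measurable
  have hf : LocallyIntegrable f volume := hf₀.congr hff
  obtain ⟨g₁, hg₁m, hg₁, hsum₁⟩ := hg₁₀.exists_measurable hff
  obtain ⟨g₂, hg₂m, hg₂, hsum₂⟩ := hg₂₀.exists_measurable hff
  set D₁ := derivSum m g₁ with hD₁
  set D₂ := derivSum (m + 1) g₂ with hD₂
  have mD₁ : Measurable D₁ := measurable_derivSum hg₁m
  have mD₂ : Measurable D₂ := measurable_derivSum hg₂m
  set c := ENNReal.ofReal (A / 2)⁻¹ with hc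
  set d := ENNReal.ofReal B⁻¹ with hd
  set G₁ : En n → ℝ≥0∞ := fun x => (c * D₁ x) ^ q₀ with hG₁
  set G₂ : En n → ℝ≥0∞ := fun x => d * D₂ x with hG₂
  have mG₁ : Measurable G₁ := by fun_prop
  have mG₂ : Measurable G₂ := by fun_prop
  set I : ℕ → ℝ → (En n → ℝ≥0∞) → En n → ℝ≥0∞ := fun j a G x =>
    ∫⁻ h, cutPow γ (γ - n + 1) (∫⁻ t, G (x + (a + t) • h) ∂(splineMeasure j)) ‖h‖ with hI
  have mI : ∀ j a G, Measurable G → Measurable (I j a G) := fun j a G hG =>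
    measurable_lintegral_cutPow_spline hG j a _ _
  have hpt : ∀ᵐ x, innerInt (m + 1) (m + 1) (A ^ (1 - s) * B ^ s) (γ / q + s - 1) γ f x ≤
      I m 0 G₁ x + I m 1 G₁ x + I (m + 1) 0 G₂ x := by
    filter_upwards [hg₁.ae_ae_enorm_kDiff_le hf hfm hg₁m 0,
      hg₁.ae_ae_enorm_kDiff_le hf hfm hg₁m 1,
      hg₂.ae_ae_enorm_kDiff_le hf hfm hg₂m 0] with x hx₀ hx₁ hx₂
    have mW : ∀ j a G, Measurable G →
        Measurable fun h : En n => ∫⁻ t, G (x + (a + t) • h) ∂(splineMeasure j) :=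
      fun j a G hG => (measurable_lintegral_splineMeasure_add hG j a).comp
        (measurable_prodMk_left (x := x))
    refine innerInt_le_of_threshold (mW m 0 G₁ mG₁) (mW m 1 G₁ mG₁) ?_
    filter_upwards [hx₀, hx₁, hx₂] with h h₀ h₁ h₂ hE
    rw [zero_smul, add_zero] at h₀ h₂
    rw [one_smul] at h₁
    rcases memE_threshold hA hB hs hq₀ hqs hE h₀ h₁ h₂ with h3 | h3 | h3
    · exact Or.inl (h3.trans_le (rpow_lintegral_splineMeasure_le hq₀ m c mD₁ 0 x h))
    · exact Or.inr (Or.inl (h3.trans_le (rpow_lintegral_splineMeasure_le hq₀ m c mD₁ 1 x h)))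
    · refine Or.inr (Or.inr (h3.trans_eq ?_))
      have m1 : Measurable fun t : ℝ => D₂ (x + (0 + t) • h) := mD₂.comp (by fun_prop)
      exact (lintegral_const_mul _ m1).symm
  have hint₁ : ∫⁻ x, G₁ x ^ p ≤ 2 ^ (p * q₀) * ((n ^ m : ℕ) : ℝ≥0∞) ^ (p * q₀) *
      (ENNReal.ofReal A⁻¹ * gradLp (p * q₀) m g₁₀) ^ (p * q₀) := by
    have e1 : ∀ x, G₁ x ^ p = c ^ (p * q₀) * D₁ x ^ (p * q₀) := fun x => by
      rw [hG₁, ← ENNReal.rpow_mul, mul_comm q₀ p, ENNReal.mul_rpow_of_nonneg _ _ hpq.le]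
    have e2 : ∫⁻ x, D₁ x ^ (p * q₀) = ∫⁻ x, derivSum m g₁₀ x ^ (p * q₀) := by
      refine lintegral_congr_ae ?_
      filter_upwards [hsum₁] with x hx
      rw [hx]
    have e3 : c = 2 * ENNReal.ofReal A⁻¹ := by
      rw [hc, ← ENNReal.ofReal_ofNat, ← ENNReal.ofReal_mul (by norm_num)]
      congr 1
      field_simp
    simp only [e1]
    rw [lintegral_const_mul _ (by fun_prop), e2]
    calc c ^ (p * q₀) * ∫⁻ x, derivSum m g₁₀ x ^ (p * q₀)
        ≤ c ^ (p * q₀) * (((n ^ m : ℕ) : ℝ≥0∞) ^ (p * q₀) * gradLp (p * q₀) m g₁₀ ^ (p * q₀)) := by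
          gcongr
          exact lintegral_derivSum_rpow_le hpq m g₁₀
      _ = _ := by
          rw [e3, ENNReal.mul_rpow_of_nonneg _ _ hpq.le, ENNReal.mul_rpow_of_nonneg _ _ hpq.le]
          ring
  have hint₂ : ∫⁻ x, G₂ x ^ p ≤ ((n ^ (m + 1) : ℕ) : ℝ≥0∞) ^ p *
      (ENNReal.ofReal B⁻¹ * gradLp p (m + 1) g₂₀) ^ p := by
    have e1 : ∀ x, G₂ x ^ p = d ^ p * D₂ x ^ p := fun x => by
      rw [hG₂, ENNReal.mul_rpow_of_nonneg _ _ hp0.le]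
    have e2 : ∫⁻ x, D₂ x ^ p = ∫⁻ x, derivSum (m + 1) g₂₀ x ^ p := by
      refine lintegral_congr_ae ?_
      filter_upwards [hsum₂] with x hx
      rw [hx]
    simp only [e1]
    rw [lintegral_const_mul _ (by fun_prop), e2]
    calc d ^ p * ∫⁻ x, derivSum (m + 1) g₂₀ x ^ p
        ≤ d ^ p * (((n ^ (m + 1) : ℕ) : ℝ≥0∞) ^ p * gradLp p (m + 1) g₂₀ ^ p) := by
          gcongr
          exact lintegral_derivSum_rpow_le hp0 (m + 1) g₂₀
      _ = _ := by
          rw [ENNReal.mul_rpow_of_nonneg _ _ hp0.le]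
          ring
  set P := (ENNReal.ofReal A⁻¹ * gradLp (p * q₀) m g₁₀) ^ (p * q₀) with hP
  set Q := (ENNReal.ofReal B⁻¹ * gradLp p (m + 1) g₂₀) ^ p with hQ
  set N₁ := 2 ^ (p * q₀) * ((n ^ m : ℕ) : ℝ≥0∞) ^ (p * q₀) with hN₁
  set N₂ := ((n ^ (m + 1) : ℕ) : ℝ≥0∞) ^ p with hN₂
  have hcast : ((3 ^ p * ((C₀ + C₁) * (2 ^ (p * q₀) * ((n ^ m : ℕ) : ℝ≥0) ^ (p * q₀)) +
      C₂ * ((n ^ (m + 1) : ℕ) : ℝ≥0) ^ p) : ℝ≥0) : ℝ≥0∞) =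
      3 ^ p * ((C₀ + C₁) * N₁ + C₂ * N₂) := by
    rw [hN₁, hN₂]
    simp only [ENNReal.coe_mul, ENNReal.coe_add, ENNReal.coe_rpow_of_nonneg _ hpq.le,
      ENNReal.coe_rpow_of_nonneg _ hp0.le, ENNReal.coe_ofNat, ENNReal.coe_natCast]
  rw [hcast]
  calc ∫⁻ x, (innerInt (m + 1) (m + 1) (A ^ (1 - s) * B ^ s) (γ / q + s - 1) γ f₀ x) ^ p
      ≤ ∫⁻ x, 3 ^ p * (I m 0 G₁ x ^ p + I m 1 G₁ x ^ p + I (m + 1) 0 G₂ x ^ p) := by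
        refine lintegral_mono_ae ?_
        filter_upwards [hpt, innerInt_ae_eq hff (m + 1) (m + 1) (A ^ (1 - s) * B ^ s)
          (γ / q + s - 1) γ] with x hx hx'
        rw [hx']
        exact (ENNReal.rpow_le_rpow hx hp0.le).trans (rpow_add_add_le_mul hp0.le _ _ _)
    _ = 3 ^ p * ((∫⁻ x, I m 0 G₁ x ^ p) + (∫⁻ x, I m 1 G₁ x ^ p) +
        ∫⁻ x, I (m + 1) 0 G₂ x ^ p) := by
        have m0 := (mI m 0 G₁ mG₁).pow_const p
        have m1 := (mI m 1 G₁ mG₁).pow_const p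
        have m2 := (mI (m + 1) 0 G₂ mG₂).pow_const p
        have m01 : Measurable fun x => I m 0 G₁ x ^ p + I m 1 G₁ x ^ p := m0.add m1
        have m012 : Measurable fun x => I m 0 G₁ x ^ p + I m 1 G₁ x ^ p + I (m + 1) 0 G₂ x ^ p :=
          m01.add m2
        rw [lintegral_const_mul _ m012, lintegral_add_left m01, lintegral_add_left m0]
    _ ≤ 3 ^ p * (C₀ * (N₁ * P) + C₁ * (N₁ * P) + C₂ * (N₂ * Q)) := by
        gcongr
        · exact (hC₀ G₁ mG₁).trans (by gcongr)
        · exact (hC₁ G₁ mG₁).trans (by gcongr)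
        · exact (hC₂ G₂ mG₂).trans (by gcongr)
    _ = 3 ^ p * ((C₀ + C₁) * N₁ * P + C₂ * N₂ * Q) := by ring
    _ ≤ 3 ^ p * (((C₀ + C₁) * N₁ + C₂ * N₂) * P + ((C₀ + C₁) * N₁ + C₂ * N₂) * Q) := by
        gcongr
        · exact le_self_add
        · exact le_add_self
    _ = _ := by ring

end Estimate

section Assembly

variable {n : ℕ}

lemma exists_weak_bound (hn : 0 < n) {p γ : ℝ} (hp : 1 ≤ p) (hγ : γ ∈ Gam p 1) (m : ℕ)
    {s q₀ q : ℝ} (hs : s ∈ Ioo (0 : ℝ) 1) (hq₀ : 1 ≤ q₀) (hq : 0 < q)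
    (hqs : 1 / q = (1 - s) / q₀ + s) :
    ∃ C : ℝ, 0 < C ∧ ∀ (f : En n → ℝ) (g₁ g₂ : (Fin n → ℕ) → En n → ℝ),
      LocallyIntegrable f volume → HasWeakDerivs m f g₁ → HasWeakDerivs (m + 1) f g₂ →
      ∀ a b lam : ℝ, 0 < a → 0 < b → 0 < lam → gradLp (p * q₀) m g₁ ≤ ENNReal.ofReal a →
      gradLp p (m + 1) g₂ ≤ ENNReal.ofReal b →
      ENNReal.ofReal lam * (∫⁻ x, (innerInt (m + 1) (m + 1) lam (γ / q + s - 1) γ f x) ^ p) ^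
        (1 / (p * q)) ≤ ENNReal.ofReal (C * (a ^ (1 - s) * b ^ s)) := by
  obtain ⟨K, hK⟩ := lintegral_innerInt_rpow_le hn hp hγ m hs hq₀ hqs
  have hp0 : 0 < p := by linarith
  have hq0 : 0 < q₀ := by linarith
  have hpq : 0 < p * q := by positivity
  refine ⟨(2 * K + 1 : ℝ) ^ (1 / (p * q)), by positivity, ?_⟩
  intro f g₁ g₂ hf hg₁ hg₂ a b lam ha hb hlam hga hgb
  set T := a ^ (1 - s) * b ^ s with hT
  have hT0 : 0 < T := by positivity
  set w := T / lam with hw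
  have hw0 : 0 < w := by positivity
  set A := a * w ^ (-(q / q₀)) with hA
  set B := b * w ^ (-q) with hB
  have hA0 : 0 < A := by positivity
  have hB0 : 0 < B := by positivity
  have hAB : A ^ (1 - s) * B ^ s = lam := by
    have e : -(q / q₀) * (1 - s) + -q * s = -1 := by
      have : q * ((1 - s) / q₀ + s) = 1 := by rw [← hqs]; field_simp
      linear_combination -this
    calc A ^ (1 - s) * B ^ s = T * (w ^ (-(q / q₀) * (1 - s)) * w ^ (-q * s)) := by
          rw [hA, hB, Real.mul_rpow ha.le (by positivity), Real.mul_rpow hb.le (by positivity),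
            Real.rpow_mul hw0.le, Real.rpow_mul hw0.le, hT]
          ring
      _ = T * w⁻¹ := by rw [← Real.rpow_add hw0, e, Real.rpow_neg_one]
      _ = lam := by rw [hw]; field_simp
  have h := hK f g₁ g₂ hf hg₁ hg₂ A B hA0 hB0
  rw [hAB] at h
  have h1 : (ENNReal.ofReal A⁻¹ * gradLp (p * q₀) m g₁) ^ (p * q₀) ≤
      ENNReal.ofReal (w ^ (p * q)) := by
    have e : (A⁻¹ * a) ^ (p * q₀) = w ^ (p * q) := by
      have : A⁻¹ * a = w ^ (q / q₀) := by
        rw [hA, Real.rpow_neg hw0.le]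
        field_simp
      rw [this, ← Real.rpow_mul hw0.le]
      congr 1
      field_simp
    rw [← e, ← ENNReal.ofReal_rpow_of_nonneg (by positivity) (by positivity),
      ENNReal.ofReal_mul (by positivity)]
    gcongr
  have h2 : (ENNReal.ofReal B⁻¹ * gradLp p (m + 1) g₂) ^ p ≤ ENNReal.ofReal (w ^ (p * q)) := by
    have e : (B⁻¹ * b) ^ p = w ^ (p * q) := by
      have : B⁻¹ * b = w ^ q := by
        rw [hB, Real.rpow_neg hw0.le]
        field_simp
      rw [this, ← Real.rpow_mul hw0.le, mul_comm q p]
    rw [← e, ← ENNReal.ofReal_rpow_of_nonneg (by positivity) (by positivity),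
      ENNReal.ofReal_mul (by positivity)]
    gcongr
  have h3 : ∫⁻ x, (innerInt (m + 1) (m + 1) lam (γ / q + s - 1) γ f x) ^ p ≤
      ENNReal.ofReal ((2 * K + 1) * w ^ (p * q)) := by
    calc _ ≤ _ := h
      _ ≤ K * (ENNReal.ofReal (w ^ (p * q)) + ENNReal.ofReal (w ^ (p * q))) := by gcongr
      _ = ENNReal.ofReal (K * (w ^ (p * q) + w ^ (p * q))) := by
          rw [ENNReal.ofReal_mul K.coe_nonneg, ENNReal.ofReal_add (by positivity) (by positivity),
            ENNReal.ofReal_coe_nnreal]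
      _ ≤ _ := by
          refine ENNReal.ofReal_le_ofReal ?_
          have : 0 ≤ w ^ (p * q) := by positivity
          linarith
  calc _ ≤ ENNReal.ofReal lam * ENNReal.ofReal ((2 * K + 1) * w ^ (p * q)) ^ (1 / (p * q)) := by
        gcongr
    _ = _ := by
        rw [ENNReal.ofReal_rpow_of_nonneg (by positivity) (by positivity),
          Real.mul_rpow (by positivity) (by positivity), ← Real.rpow_mul hw0.le,
          mul_one_div_cancel hpq.ne', Real.rpow_one, ← ENNReal.ofReal_mul hlam.le]
        congr 1
        rw [hw]
        field_simp

end Assembly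

open MeasureTheory Set
open scoped ENNReal

/-- fractional Gagliardo–Nirenberg-type inequality, case `q₀ < ∞`. -/
theorem statement15 (n k : ℕ) (hn : 0 < n) (hk : 0 < k) (p γ s q₀ q : ℝ)
    (hp : 1 ≤ p) (hγ : γ ∈ Gam p 1) (hs : s ∈ Ioo (0 : ℝ) 1) (hq₀ : 1 ≤ q₀)
    (hq : q ∈ Icc 1 q₀) (hqs : 1 / q = (1 - s) / q₀ + s) :
    ∃ C : ℝ, 0 < C ∧
      ∀ (f : En n → ℝ) (g₁ g₂ : (Fin n → ℕ) → En n → ℝ),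
        LocallyIntegrable f volume →
        HasWeakDerivs (k - 1) f g₁ → HasWeakDerivs k f g₂ →
        gradLp (p * q₀) (k - 1) g₁ < ⊤ → gradLp p k g₂ < ⊤ →
        (⨆ lam ∈ Ioi (0 : ℝ), ENNReal.ofReal lam *
            (∫⁻ x, (innerInt k k lam (γ / q + s - 1) γ f x) ^ p) ^ (1 / (p * q)))
          ≤ ENNReal.ofReal C * gradLp (p * q₀) (k - 1) g₁ ^ (1 - s)
              * gradLp p k g₂ ^ s := by
  obtain ⟨m, rfl⟩ : ∃ m, k = m + 1 := ⟨k - 1, by omega⟩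
  obtain ⟨C, hC, hbound⟩ := exists_weak_bound hn hp hγ m hs hq₀ (by linarith [hq.1]) hqs
  refine ⟨C, hC, fun f g₁ g₂ hf hg₁ hg₂ h₁ h₂ => iSup₂_le fun lam hlam => ?_⟩
  rw [Nat.add_sub_cancel] at *
  set α := (gradLp (p * q₀) m g₁).toReal with hα
  set β := (gradLp p (m + 1) g₂).toReal with hβ
  have hs' : 0 ≤ 1 - s := by linarith [hs.2]
  have e : ENNReal.ofReal C * gradLp (p * q₀) m g₁ ^ (1 - s) * gradLp p (m + 1) g₂ ^ s =
      ENNReal.ofReal (C * ((α + 0) ^ (1 - s) * (β + 0) ^ s)) := by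
    rw [add_zero, add_zero, ENNReal.ofReal_mul hC.le, ENNReal.ofReal_mul (by positivity),
      ← ENNReal.ofReal_rpow_of_nonneg ENNReal.toReal_nonneg hs',
      ← ENNReal.ofReal_rpow_of_nonneg ENNReal.toReal_nonneg hs.1.le,
      ENNReal.ofReal_toReal h₁.ne, ENNReal.ofReal_toReal h₂.ne, mul_assoc]
  have hcont : Continuous fun ε : ℝ =>
      ENNReal.ofReal (C * ((α + ε) ^ (1 - s) * (β + ε) ^ s)) :=
    ENNReal.continuous_ofReal.comp (continuous_const.mul
      (((continuous_const.add continuous_id).rpow_const fun _ => Or.inr hs').mul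
        ((continuous_const.add continuous_id).rpow_const fun _ => Or.inr hs.1.le)))
  rw [e]
  refine ge_of_tendsto (hcont.continuousWithinAt (s := Ioi 0) (x := 0)) ?_
  filter_upwards [self_mem_nhdsWithin] with ε (hε : 0 < ε)
  refine hbound f g₁ g₂ hf hg₁ hg₂ (α + ε) (β + ε) lam (by positivity) (by positivity) hlam ?_ ?_
  · exact ENNReal.le_ofReal_iff_toReal_le h₁.ne (by positivity) |>.2 (by linarith)
  · exact ENNReal.le_ofReal_iff_toReal_le h₂.ne (by positivity) |>.2 (by linarith)
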